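/- arXiv:1609.02695 — 2 statements merged into one kernel-verified Lean document; each statement's English description precedes it below -/
import Mathlib

section
/- (Classification of fourfolds with trivial canonical bundle in even orthogonal Grassmannians OGr(k,2n) with k ≤ n−3.) Let 1 ≤ k ≤ n−3 and let β¹, …, β^m be nonzero weights for OGr(k,2n) such that: no β^i equals (1,0,…,0); at least one β^i has non-integer entries or has (β^i_{k+1}, …, β^i_n) ≠ (0,…,0); ∑_i rank(β^i) = k(2n−k) − k(k+1)/2 − 4; and ∑_i dex(β^i) = 2n − k − 1. Then k = 2 and, up to reordering and up to simultaneously replacing the last entry β^i_n by −β^i_n for every i, (n, (β¹,…,β^m)) is one of the following seven (0^j denotes j consecutive zeros): (1) n=5: (1/2,1/2,1/2,1/2,1/2) twice, (3,3,0,0,0); (2) n=5: (1/2,1/2,1/2,1/2,1/2), (1/2,1/2,1/2,1/2,−1/2), (3,3,0,0,0); (3) n=5: (1/2,1/2,1/2,1/2,1/2), (1,1,0,0,0) five times; (4) n=5: (1/2,1/2,1/2,1/2,1/2), (2,0,0,0,0), (1,1,0,0,0) twice; (5) n=6: (1/2,1/2,1/2,1/2,1/2,1/2), (1,1,0^4)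 five times; (6) n=6: (1/2,1/2,1/2,1/2,1/2,1/2), (2,0^5), (1,1,0^4) twice; (7) n=7: (1/2,1/2,1/2,1/2,1/2,1/2,1/2), (3,3,0^5). -/
open Finset

/-- Weyl dimension formula `D_r` for `sl(r)`, applied to the entries
`β 0, …, β (r-1)` (0-indexed versions of `β₁, …, β_r`). -/
def slDim (r : ℕ) (β : ℕ → ℚ) : ℚ :=
  ∏ i ∈ Finset.range r, ∏ j ∈ Finset.range r,
    if i < j then ((j : ℚ) - (i : ℚ) + β i - β j) / ((j : ℚ) - (i : ℚ)) else 1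

/-- Weyl dimension formula `C_m` for `sp(2m)`. -/
def spDim (m : ℕ) (β : ℕ → ℚ) : ℚ :=
  slDim m β *
    ∏ i ∈ Finset.range m, ∏ j ∈ Finset.range m,
      if i ≤ j then
        ((2 * m : ℚ) - (i : ℚ) - (j : ℚ) + β i + β j) /
          ((2 * m : ℚ) - (i : ℚ) - (j : ℚ))
      else 1

/-- Weyl dimension formula `B_m` for `so(2m+1)`. -/
def soOddDim (m : ℕ) (β : ℕ → ℚ) : ℚ :=
  slDim m β *
    ∏ i ∈ Finset.range m, ∏ j ∈ Finset.range m,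
      if i ≤ j then
        ((2 * m : ℚ) - 1 - (i : ℚ) - (j : ℚ) + β i + β j) /
          ((2 * m : ℚ) - 1 - (i : ℚ) - (j : ℚ))
      else 1

/-- Weyl dimension formula `E_m` for `so(2m)`. -/
def soEvenDim (m : ℕ) (β : ℕ → ℚ) : ℚ :=
  slDim m β *
    ∏ i ∈ Finset.range m, ∏ j ∈ Finset.range m,
      if i < j then
        ((2 * m : ℚ) - 2 - (i : ℚ) - (j : ℚ) + β i + β j) /
          ((2 * m : ℚ) - 2 - (i : ℚ) - (j : ℚ))
      else 1

/-- The tuple determined by a list, extended by zeros. -/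
def lw (l : List ℚ) : ℕ → ℚ := fun i => l.getD i 0

/-- `β₁ + ⋯ + β_k` (the sum of the first `k` entries). -/
def headSum (k : ℕ) (β : ℕ → ℚ) : ℚ := ∑ i ∈ Finset.range k, β i

/-- A weight for the ordinary Grassmannian `Gr(k,n)`: integers
`β₁ ≥ β₂ ≥ ⋯ ≥ β_n = 0`, extended by zeros beyond position `n`. -/
def IsGrWeight (n : ℕ) (β : ℕ → ℚ) : Prop :=
  (∀ i, ∃ z : ℤ, β i = (z : ℚ)) ∧ (∀ i j, i ≤ j → β j ≤ β i) ∧ ∀ i, n - 1 ≤ i → β i = 0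

/-- `rank(β) = D_k(β₁,…,β_k) ⬝ D_{n-k}(β_{k+1},…,β_n)` on `Gr(k,n)`. -/
def grRank (k n : ℕ) (β : ℕ → ℚ) : ℚ := slDim k β * slDim (n - k) (fun i => β (k + i))

/-- `dex(β) = (|β|₁/k − |β|₂/(n−k)) ⬝ rank(β)` on `Gr(k,n)`. -/
def grDex (k n : ℕ) (β : ℕ → ℚ) : ℚ :=
  (headSum k β / (k : ℚ) -
      (∑ i ∈ Finset.range (n - k), β (k + i)) / ((n : ℚ) - (k : ℚ))) * grRank k n β

/-- A weight for the symplectic Grassmannian `IGr(k,2n)`: integers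
`β₁ ≥ ⋯ ≥ β_n ≥ 0`, extended by zeros beyond position `n`. -/
def IsIGrWeight (n : ℕ) (β : ℕ → ℚ) : Prop :=
  (∀ i, ∃ z : ℤ, β i = (z : ℚ)) ∧ (∀ i j, i ≤ j → β j ≤ β i) ∧ ∀ i, n ≤ i → β i = 0

/-- `rank(β) = D_k(β₁,…,β_k) ⬝ C_{n-k}(β_{k+1},…,β_n)` on `IGr(k,2n)`. -/
def igrRank (k n : ℕ) (β : ℕ → ℚ) : ℚ := slDim k β * spDim (n - k) (fun i => β (k + i))

/-- `dex(β) = ((β₁+⋯+β_k)/k) ⬝ rank(β)` on `IGr(k,2n)`. -/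
def igrDex (k n : ℕ) (β : ℕ → ℚ) : ℚ := headSum k β / (k : ℚ) * igrRank k n β

/-- A weight for the odd orthogonal Grassmannian `OGr(k,2n+1)`:
`β₁ ≥ ⋯ ≥ β_n ≥ 0`, all entries integers or all half-odd-integers,
extended by zeros beyond position `n`. -/
def IsOGrOddWeight (n : ℕ) (β : ℕ → ℚ) : Prop :=
  ((∀ i, i < n → ∃ z : ℤ, β i = (z : ℚ)) ∨
    (∀ i, i < n → ∃ z : ℤ, β i = (z : ℚ) + 1/2)) ∧
  (∀ i j, i ≤ j → j < n → β j ≤ β i) ∧ (∀ i, i < n → 0 ≤ β i) ∧ ∀ i, n ≤ i → β i = 0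

/-- `rank(β) = D_k(β₁,…,β_k) ⬝ B_{n-k}(β_{k+1},…,β_n)` on `OGr(k,2n+1)`. -/
def ogrOddRank (k n : ℕ) (β : ℕ → ℚ) : ℚ :=
  slDim k β * soOddDim (n - k) (fun i => β (k + i))

/-- `dex(β) = ((β₁+⋯+β_k)/k) ⬝ rank(β)` on `OGr(k,2n+1)`. -/
def ogrOddDex (k n : ℕ) (β : ℕ → ℚ) : ℚ := headSum k β / (k : ℚ) * ogrOddRank k n β

/-- A weight for the even orthogonal Grassmannian `OGr(k,2n)`:
`β₁ ≥ ⋯ ≥ β_{n-1} ≥ |β_n|`, all entries integers or all half-odd-integers,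
extended by zeros beyond position `n`. -/
def IsOGrEvenWeight (n : ℕ) (β : ℕ → ℚ) : Prop :=
  ((∀ i, i < n → ∃ z : ℤ, β i = (z : ℚ)) ∨
    (∀ i, i < n → ∃ z : ℤ, β i = (z : ℚ) + 1/2)) ∧
  (∀ i j, i ≤ j → j + 1 < n → β j ≤ β i) ∧
  (∀ i, i + 1 < n → |β (n - 1)| ≤ β i) ∧ ∀ i, n ≤ i → β i = 0

/-- `rank(β) = D_k(β₁,…,β_k) ⬝ E_{n-k}(β_{k+1},…,β_n)` on `OGr(k,2n)`. -/
def ogrEvenRank (k n : ℕ) (β : ℕ → ℚ) : ℚ :=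
  slDim k β * soEvenDim (n - k) (fun i => β (k + i))

/-- `dex(β) = ((β₁+⋯+β_k)/k) ⬝ rank(β)` on `OGr(k,2n)`. -/
def ogrEvenDex (k n : ℕ) (β : ℕ → ℚ) : ℚ := headSum k β / (k : ℚ) * ogrEvenRank k n β

/-- Replace the last entry `β_n` by its negative. -/
def negLast (n : ℕ) (β : ℕ → ℚ) : ℕ → ℚ := fun i => if i = n - 1 then -β i else β i

/-- Peel off the smallest index from a product over pairs `i < j`. -/
theorem prod_pairs_succ (m : ℕ) (f : ℕ → ℕ → ℚ) :
    (∏ i ∈ range (m + 1), ∏ j ∈ range (m + 1), if i < j then f i j else 1) =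
      (∏ i ∈ range m, ∏ j ∈ range m, if i < j then f (i + 1) (j + 1) else 1) *
        ∏ j ∈ range m, f 0 (j + 1) := by
  rw [prod_range_succ']
  congr 1
  · refine prod_congr rfl fun i _ => ?_
    rw [prod_range_succ']
    simp
  · rw [prod_range_succ']
    simp

theorem slDim_succ (m : ℕ) (γ : ℕ → ℚ) :
    slDim (m + 1) γ = slDim m (fun i => γ (i + 1)) *
      ∏ j ∈ range m, ((j : ℚ) + 1 + γ 0 - γ (j + 1)) / ((j : ℚ) + 1) := by
  unfold slDim
  rw [prod_pairs_succ m fun i j => ((j : ℚ) - i + γ i - γ j) / ((j : ℚ) - i)]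
  simp

/-- The contribution to `soEvenDim (m + 1) γ` of the two roots pairing the index `0` with the
index `j + 1`, where `x = γ 0` and `y = γ (j + 1)`. -/
def rowFactor (m j : ℕ) (x y : ℚ) : ℚ :=
  ((j : ℚ) + 1 + x - y) / ((j : ℚ) + 1) *
    ((2 * m - ((j : ℚ) + 1) + x + y) / (2 * m - ((j : ℚ) + 1)))

theorem soEvenDim_succ (m : ℕ) (γ : ℕ → ℚ) :
    soEvenDim (m + 1) γ = soEvenDim m (fun i => γ (i + 1)) *
      ∏ j ∈ range m, rowFactor m j (γ 0) (γ (j + 1)) := by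
  unfold soEvenDim rowFactor
  rw [slDim_succ, prod_pairs_succ m fun i j =>
    ((2 * (m + 1 : ℕ) : ℚ) - 2 - (i : ℚ) - (j : ℚ) + γ i + γ j) /
      ((2 * (m + 1 : ℕ) : ℚ) - 2 - (i : ℚ) - (j : ℚ)), prod_mul_distrib]
  have h1 : ∀ i j : ℕ, ((2 * (m + 1 : ℕ) : ℚ) - 2 - ((i + 1 : ℕ) : ℚ) - ((j + 1 : ℕ) : ℚ)) =
      2 * m - 2 - i - j := fun i j => by push_cast; ring
  have h2 : ∀ j : ℕ, ((2 * (m + 1 : ℕ) : ℚ) - 2 - ((0 : ℕ) : ℚ) - ((j + 1 : ℕ) : ℚ)) =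
      2 * m - (j + 1) := fun j => by push_cast; ring
  simp only [h1, h2]
  ring

theorem rowFactor_ge {m j : ℕ} (hj : j < m) {x y c : ℚ} (hc : c ≤ x) (hxy : |y| ≤ x) :
    (2 * m - ((j : ℚ) + 1) + 2 * c) / (2 * m - ((j : ℚ) + 1)) ≤ rowFactor m j x y := by
  have hjm : (j : ℚ) + 1 ≤ m := by exact_mod_cast hj
  obtain ⟨hy1, hy2⟩ := abs_le.mp hxy
  have hp : (0 : ℚ) < (j : ℚ) + 1 := by positivity
  have hq : (0 : ℚ) < 2 * m - ((j : ℚ) + 1) := by linarith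
  rw [rowFactor, div_mul_div_comm, div_le_div_iff₀ hq (mul_pos hp hq)]
  have key : ((j : ℚ) + 1) * (2 * m - (j + 1) + 2 * c) ≤
      ((j : ℚ) + 1 + x - y) * (2 * m - ((j : ℚ) + 1) + x + y) := by
    nlinarith [mul_nonneg hp.le (sub_nonneg.2 hc),
      mul_nonneg (sub_nonneg.2 hjm) (sub_nonneg.2 hy2),
      mul_nonneg (sub_nonneg.2 hy2) (neg_le_iff_add_nonneg.1 hy1)]
  nlinarith [mul_le_mul_of_nonneg_right key hq.le]

theorem one_le_rowFactor {m j : ℕ} (hj : j < m) {x y : ℚ} (hxy : |y| ≤ x) :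
    1 ≤ rowFactor m j x y := by
  have hjm : (j : ℚ) + 1 ≤ m := by exact_mod_cast hj
  have hq : (0 : ℚ) < 2 * m - ((j : ℚ) + 1) := by
    have : (0 : ℚ) ≤ j := j.cast_nonneg
    linarith
  have h := rowFactor_ge hj ((abs_nonneg y).trans hxy) hxy
  rwa [mul_zero, add_zero, div_self hq.ne'] at h

theorem prod_telescope_add (t : ℕ) :
    ∏ j ∈ range t, ((j : ℚ) + 1 + 1) / ((j : ℚ) + 1) = t + 1 := by
  induction t with
  | zero => simp
  | succ t ih =>
    rw [prod_range_succ, ih]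
    have : (t : ℚ) + 1 ≠ 0 := by positivity
    push_cast
    field_simp

theorem prod_telescope_sub {m t : ℕ} (hm : 1 ≤ m) (ht : t ≤ m) :
    ∏ j ∈ range t, (2 * m - ((j : ℚ) + 1) + 1) / (2 * m - ((j : ℚ) + 1)) =
      2 * m / (2 * m - t) := by
  have hm' : (1 : ℚ) ≤ m := by exact_mod_cast hm
  induction t with
  | zero =>
    have : (m : ℚ) ≠ 0 := by positivity
    simp [this]
  | succ t ih =>
    have ht' : (t : ℚ) + 1 ≤ m := by exact_mod_cast ht
    rw [prod_range_succ, ih (by omega)]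
    have h1 : (2 * m - t : ℚ) ≠ 0 := by intro h; linarith
    have h2 : (2 * m - (t + 1) : ℚ) ≠ 0 := by intro h; linarith
    have h3 : (2 * m - ((t : ℚ) + 1) + 1) = 2 * m - t := by ring
    push_cast
    rw [h3]
    field_simp

theorem prod_telescope_sub_self {m : ℕ} (hm : 1 ≤ m) :
    ∏ j ∈ range m, (2 * m - ((j : ℚ) + 1) + 1) / (2 * m - ((j : ℚ) + 1)) = 2 := by
  rw [prod_telescope_sub hm le_rfl]
  have : (m : ℚ) ≠ 0 := by positivity
  field_simp
  ring

/-- The inequalities `γ₁ ≥ ⋯ ≥ γ_{m-1} ≥ |γ_m|`. -/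
def IsDominant (m : ℕ) (γ : ℕ → ℚ) : Prop := ∀ i j, i < j → j < m → |γ j| ≤ γ i

theorem IsDominant.tail {m : ℕ} {γ : ℕ → ℚ} (h : IsDominant (m + 1) γ) :
    IsDominant m fun i => γ (i + 1) :=
  fun i j hij hj => h _ _ (by omega) (by omega)

theorem IsDominant.shift {k m : ℕ} {γ : ℕ → ℚ} (h : IsDominant (k + m) γ) :
    IsDominant m fun i => γ (k + i) :=
  fun i j hij hj => h _ _ (by omega) (by omega)

theorem IsDominant.mono {k m : ℕ} (hkm : k ≤ m) {γ : ℕ → ℚ} (h : IsDominant m γ) :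
    IsDominant k γ :=
  fun i j hij hj => h i j hij (by omega)

theorem one_le_slDim {m : ℕ} {γ : ℕ → ℚ} (h : IsDominant m γ) : 1 ≤ slDim m γ := by
  induction m generalizing γ with
  | zero => simp [slDim]
  | succ m ih =>
    rw [slDim_succ]
    refine one_le_mul_of_one_le_of_one_le (ih h.tail) (one_le_prod fun j hj => ?_)
    have h1 := (le_abs_self _).trans (h 0 (j + 1) (by omega) (by simpa using hj))
    rw [one_le_div (by positivity)]
    linarith

theorem one_le_prod_rowFactor {m : ℕ} {γ : ℕ → ℚ} (h : IsDominant (m + 1) γ) :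
    1 ≤ ∏ j ∈ range m, rowFactor m j (γ 0) (γ (j + 1)) :=
  one_le_prod fun j hj =>
    one_le_rowFactor (by simpa using hj) (h 0 (j + 1) (by omega) (by simpa using hj))

theorem one_le_soEvenDim {m : ℕ} {γ : ℕ → ℚ} (h : IsDominant m γ) : 1 ≤ soEvenDim m γ := by
  induction m generalizing γ with
  | zero => simp [soEvenDim, slDim]
  | succ m ih =>
    rw [soEvenDim_succ]
    exact one_le_mul_of_one_le_of_one_le (ih h.tail) (one_le_prod_rowFactor h)

theorem soEvenDim_of_eq_zero {m : ℕ} {γ : ℕ → ℚ} (h : ∀ i < m, γ i = 0) :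
    soEvenDim m γ = 1 := by
  induction m generalizing γ with
  | zero => simp [soEvenDim, slDim]
  | succ m ih =>
    rw [soEvenDim_succ, ih fun i hi => h _ (by omega), one_mul]
    refine prod_eq_one fun j hj => ?_
    have hj' : j < m := by simpa using hj
    have hjm : (j : ℚ) + 1 ≤ m := by exact_mod_cast hj'
    have hp : (0 : ℚ) < (j : ℚ) + 1 := by positivity
    have hq : (2 * m - ((j : ℚ) + 1)) ≠ 0 := by intro; linarith
    rw [h 0 (by omega), h (j + 1) (by omega), rowFactor]
    simp [hp.ne', hq]

theorem two_le_prod_rowFactor {m : ℕ} (hm : 1 ≤ m) {γ : ℕ → ℚ} (h : IsDominant (m + 1) γ)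
    (h0 : 1 / 2 ≤ γ 0) : 2 ≤ ∏ j ∈ range m, rowFactor m j (γ 0) (γ (j + 1)) := by
  rw [← prod_telescope_sub_self hm]
  refine prod_le_prod (fun j hj => ?_) fun j hj => ?_
  · have hj' : j < m := by simpa using hj
    have hjm : (j : ℚ) + 1 ≤ m := by exact_mod_cast hj'
    have hp : (0 : ℚ) < (j : ℚ) + 1 := by positivity
    exact div_nonneg (by linarith) (by linarith)
  · have hj' : j < m := by simpa using hj
    have := rowFactor_ge hj' h0 (h 0 (j + 1) (by omega) (by omega))
    rwa [mul_one_div_cancel two_ne_zero] at this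

theorem two_pow_le_soEvenDim {m : ℕ} {γ : ℕ → ℚ} (h : IsDominant (m + 1) γ)
    (hγ : ∀ i < m, 1 / 2 ≤ γ i) : 2 ^ m ≤ soEvenDim (m + 1) γ := by
  induction m generalizing γ with
  | zero => simpa using one_le_soEvenDim h
  | succ m ih =>
    rw [soEvenDim_succ, pow_succ]
    exact mul_le_mul (ih h.tail fun i hi => hγ _ (by omega))
      (two_le_prod_rowFactor (by omega) h (hγ 0 (by omega))) (by norm_num)
      (zero_le_one.trans (one_le_soEvenDim h.tail))

/-- The two half-spin representations of `so(2m)` have dimension `2 ^ (m - 1)`. -/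
theorem soEvenDim_halfSpin {m : ℕ} {γ : ℕ → ℚ} (hγ : ∀ i < m, γ i = 1 / 2)
    (hlast : γ m = 1 / 2 ∨ γ m = -(1 / 2)) : soEvenDim (m + 1) γ = 2 ^ m := by
  induction m generalizing γ with
  | zero => simp [soEvenDim, slDim]
  | succ m ih =>
    rw [soEvenDim_succ, pow_succ, 
      ih (γ := fun i => γ (i + 1)) (fun i hi => hγ _ (by omega)) hlast,
      ← prod_telescope_sub_self (m := m + 1) (by omega)]
    congr 1
    refine prod_congr rfl fun j hj => ?_
    have hj' : j < m + 1 := by simpa using hj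
    have hjm : (j : ℚ) + 1 ≤ (m + 1 : ℕ) := by exact_mod_cast hj'
    have hp : (0 : ℚ) < (j : ℚ) + 1 := by positivity
    have hq : (2 * ((m + 1 : ℕ) : ℚ) - ((j : ℚ) + 1)) ≠ 0 := by intro; linarith
    rw [rowFactor, hγ 0 (by omega), div_mul_div_comm, div_eq_div_iff (mul_ne_zero hp.ne' hq) hq]
    rcases Nat.lt_succ_iff_lt_or_eq.mp hj' with hj'' | rfl
    · rw [hγ (j + 1) (by omega)]
      ring
    · rcases hlast with h | h <;> rw [h] <;> push_cast <;> ring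

theorem IsDominant.one_le_of_int {m : ℕ} (hm : 2 ≤ m) {γ : ℕ → ℚ} (h : IsDominant m γ)
    (hint : ∀ i < m, ∃ z : ℤ, γ i = z) (hne : ∃ i < m, γ i ≠ 0) : 1 ≤ γ 0 := by
  obtain ⟨i, him, hi⟩ := hne
  have h0 : 0 < γ 0 := by
    rcases Nat.eq_zero_or_pos i with rfl | hpos
    · exact lt_of_le_of_ne ((abs_nonneg _).trans (h 0 1 (by omega) (by omega))) (Ne.symm hi)
    · exact (abs_pos.mpr hi).trans_le (h 0 i hpos him)
  obtain ⟨z, hz⟩ := hint 0 (by omega)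
  rw [hz] at h0 ⊢
  exact_mod_cast h0

theorem three_le_soEvenDim_two {γ : ℕ → ℚ} (h : IsDominant 2 γ) (h0 : 1 ≤ γ 0) :
    3 ≤ soEvenDim 2 γ := by
  have h1 := rowFactor_ge (m := 1) (j := 0) one_pos h0 (h 0 1 (by omega) (by omega))
  have h2 := one_le_soEvenDim h.tail
  rw [soEvenDim_succ, prod_range_one]
  norm_num at h1 ⊢
  nlinarith

theorem two_mul_le_prod_rowFactor {m : ℕ} (hm : 1 ≤ m) {γ : ℕ → ℚ} (h0 : 1 ≤ γ 0)
    (htail : ∀ i < m, γ (i + 1) = 0) :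
    2 * ((m : ℚ) + 1) ≤ ∏ j ∈ range m, rowFactor m j (γ 0) (γ (j + 1)) := by
  have h : (2 * ((m : ℚ) + 1)) = ∏ j ∈ range m, (((j : ℚ) + 1 + 1) / ((j : ℚ) + 1) *
      ((2 * m - ((j : ℚ) + 1) + 1) / (2 * m - ((j : ℚ) + 1)))) := by
    rw [prod_mul_distrib, prod_telescope_add, prod_telescope_sub_self hm, mul_comm]
  rw [h]
  refine prod_le_prod (fun j hj => ?_) fun j hj => ?_
  all_goals
    have hj' : j < m := by simpa using hj
    have hjm : (j : ℚ) + 1 ≤ m := by exact_mod_cast hj'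
    have hp : (0 : ℚ) < (j : ℚ) + 1 := by positivity
    have hq : (0 : ℚ) < 2 * m - ((j : ℚ) + 1) := by linarith
  · positivity
  · rw [rowFactor, htail j hj', sub_zero, add_zero]
    gcongr

/-- A nontrivial representation of `so(2m)`, `m ≥ 3`, with integral highest weight has dimension at
least `2m`. -/
theorem two_mul_le_soEvenDim {m : ℕ} (hm : 3 ≤ m) {γ : ℕ → ℚ} (h : IsDominant m γ)
    (hint : ∀ i < m, ∃ z : ℤ, γ i = z) (hne : ∃ i < m, γ i ≠ 0) :
    2 * (m : ℚ) ≤ soEvenDim m γ := by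
  induction m using Nat.strong_induction_on generalizing γ with
  | _ m ih =>
    obtain ⟨m, rfl⟩ : ∃ r, m = r + 1 := ⟨m - 1, by omega⟩
    have h0 := h.one_le_of_int (by omega) hint hne
    have htail := one_le_soEvenDim h.tail
    rw [soEvenDim_succ]
    push_cast
    by_cases hz : ∃ i < m, γ (i + 1) ≠ 0
    · have hrow := two_le_prod_rowFactor (by omega) h (by linarith)
      have hm2 : (2 : ℚ) ≤ m := by exact_mod_cast (by omega : 2 ≤ m)
      have hint' : ∀ i < m, ∃ z : ℤ, γ (i + 1) = z := fun i hi => hint _ (by omega)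
      have hdim : 2 * (m : ℚ) - 1 ≤ soEvenDim m fun i => γ (i + 1) := by
        rcases (show m = 2 ∨ 3 ≤ m by omega) with rfl | hm3
        · have := three_le_soEvenDim_two h.tail (h.tail.one_le_of_int le_rfl hint' hz)
          norm_num
          exact this
        · linarith [ih m (by omega) hm3 h.tail hint' hz]
      nlinarith
    · push Not at hz
      have hrow := two_mul_le_prod_rowFactor (by omega) h0 hz
      nlinarith

section Weights

variable {n : ℕ} {β : ℕ → ℚ}

theorem IsOGrEvenWeight.isDominant (hβ : IsOGrEvenWeight n β) : IsDominant n β := by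
  obtain ⟨-, hmono, hlast, -⟩ := hβ
  intro i j hij hj
  rcases (show j + 1 < n ∨ j = n - 1 by omega) with hj' | rfl
  · rw [abs_of_nonneg ((abs_nonneg _).trans (hlast j hj'))]
    exact hmono i j hij.le hj'
  · exact hlast i (by omega)

theorem IsOGrEvenWeight.nonneg (hβ : IsOGrEvenWeight n β) {i : ℕ} (hi : i + 1 < n) : 0 ≤ β i :=
  (abs_nonneg _).trans (hβ.2.2.1 i hi)

theorem IsOGrEvenWeight.half_le (hβ : IsOGrEvenWeight n β)
    (hhalf : ∀ i, i < n → ∃ z : ℤ, β i = (z : ℚ) + 1 / 2) {i : ℕ} (hi : i + 1 < n) :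
    1 / 2 ≤ β i := by
  have h := hβ.nonneg hi
  obtain ⟨z, hz⟩ := hhalf i (by omega)
  rw [hz] at h ⊢
  have hz0 : (-1 : ℚ) < z := by linarith
  have hz1 : (0 : ℤ) ≤ z := by
    have : (-1 : ℤ) < z := by exact_mod_cast hz0
    omega
  have : (0 : ℚ) ≤ z := by exact_mod_cast hz1
  linarith

theorem IsOGrEvenWeight.two_le_add (hn : 3 ≤ n) (hβ : IsOGrEvenWeight n β)
    (hint : ∀ i, i < n → ∃ z : ℤ, β i = (z : ℚ)) (hne : β ≠ 0) (hne' : β ≠ lw [1]) :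
    2 ≤ β 0 + β 1 := by
  have hdom := hβ.isDominant
  have h0 : 1 ≤ β 0 := by
    refine hdom.one_le_of_int (by omega) hint ?_
    by_contra! hz
    exact hne (funext fun i => (lt_or_ge i n).elim (hz i) (hβ.2.2.2 i))
  have h1 := hβ.nonneg (i := 1) (by omega)
  obtain ⟨a, ha⟩ := hint 0 (by omega)
  obtain ⟨b, hb⟩ := hint 1 (by omega)
  by_contra! hlt
  have hb0 : β 1 = 0 := by
    rw [ha] at h0 hlt
    rw [hb] at h1 hlt ⊢
    norm_cast at *
    omega
  have ha1 : β 0 = 1 := by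
    rw [hb0, add_zero] at hlt
    rw [ha] at h0 hlt ⊢
    norm_cast at *
    omega
  refine hne' (funext fun i => ?_)
  match i with
  | 0 => simp [lw, ha1]
  | 1 => simp [lw, hb0]
  | i + 2 =>
    rcases lt_or_ge (i + 2) n with hi | hi
    · have := hdom 1 (i + 2) (by omega) hi
      rw [hb0, abs_nonpos_iff] at this
      simp [lw, this]
    · simp [lw, hβ.2.2.2 _ hi]

theorem IsOGrEvenWeight.one_le_rank {k : ℕ} (hkn : k ≤ n) (hβ : IsOGrEvenWeight n β) :
    1 ≤ ogrEvenRank k n β := by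
  have hdom := hβ.isDominant
  refine one_le_mul_of_one_le_of_one_le (one_le_slDim (hdom.mono hkn)) (one_le_soEvenDim ?_)
  rw [← Nat.add_sub_cancel' hkn] at hdom
  exact hdom.shift

theorem IsOGrEvenWeight.slope_ge {k : ℕ} (hk : 2 ≤ k) (hkn : k < n) (hβ : IsOGrEvenWeight n β)
    (hne : β ≠ 0) (hne' : β ≠ lw [1]) {c : ℚ} (hc : c ≤ 1 / 2) (hck : c * k ≤ 2) :
    c * ogrEvenRank k n β ≤ ogrEvenDex k n β := by
  have hk0 : (0 : ℚ) < k := by positivity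
  refine mul_le_mul_of_nonneg_right ?_ (zero_le_one.trans (hβ.one_le_rank hkn.le))
  rw [le_div_iff₀ hk0]
  rcases hβ.1 with hint | hhalf
  · refine hck.trans ((hβ.two_le_add (by omega) hint hne hne').trans ?_)
    rw [headSum, ← sum_range_add_sum_Ico β hk, sum_range_succ, sum_range_one]
    have : 0 ≤ ∑ i ∈ Ico 2 k, β i :=
      sum_nonneg fun i hi => hβ.nonneg (by simp at hi; omega)
    linarith
  · have h : ∑ _i ∈ range k, (1 / 2 : ℚ) ≤ headSum k β :=
      sum_le_sum fun i hi => hβ.half_le hhalf (by simp at hi; omega)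
    rw [sum_const, card_range, nsmul_eq_mul] at h
    nlinarith

theorem IsOGrEvenWeight.rank_one_gt (hn : 4 ≤ n) (hβ : IsOGrEvenWeight n β)
    (hnew : (∃ i, i < n ∧ ∀ z : ℤ, β i ≠ (z : ℚ)) ∨ ∃ j, 1 ≤ j ∧ j < n ∧ β j ≠ 0) :
    2 * (n : ℚ) - 6 < ogrEvenRank 1 n β := by
  obtain ⟨m, rfl⟩ : ∃ m, n = 1 + (m + 1 + 1) := ⟨n - 3, by omega⟩
  have hdom := hβ.isDominant
  have htail := hdom.shift
  have hrank : ogrEvenRank 1 (1 + (m + 1 + 1)) β = soEvenDim (m + 1 + 1) fun i => β (1 + i) := by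
    simp [ogrEvenRank, slDim]
  rw [hrank]
  rcases hβ.1 with hint | hhalf
  · obtain ⟨j, hj1, hj, hj0⟩ := hnew.resolve_left fun ⟨i, hi, hz⟩ => by
      obtain ⟨z, hz'⟩ := hint i hi
      exact hz z hz'
    have := two_mul_le_soEvenDim (by omega) htail (fun i hi => hint _ (by omega))
      ⟨j - 1, by omega, by rwa [Nat.add_sub_cancel' hj1]⟩
    push_cast at this ⊢
    linarith
  · have h1 := two_pow_le_soEvenDim htail fun i hi => hβ.half_le hhalf (by omega)
    have h2 : ((m : ℚ) + 1) ≤ 2 ^ m := by exact_mod_cast Nat.lt_two_pow_self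
    rw [pow_succ] at h1
    push_cast
    linarith

end Weights

/-- The highest weight `(1/2, …, 1/2)` of a half-spin representation of `so(2n)`. -/
def halfSpinWeight (n : ℕ) : ℕ → ℚ := fun i => if i < n then 1 / 2 else 0

theorem slDim_two (γ : ℕ → ℚ) : slDim 2 γ = γ 0 - γ 1 + 1 := by
  simp [slDim, prod_range_succ]
  ring

theorem headSum_two (γ : ℕ → ℚ) : headSum 2 γ = γ 0 + γ 1 := by
  simp [headSum, sum_range_succ]

theorem ogrEvenRank_two_of_halfSpin {n : ℕ} (hn : 4 ≤ n) {β : ℕ → ℚ}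
    (hβ : β = halfSpinWeight n ∨ β = negLast n (halfSpinWeight n)) :
    ogrEvenRank 2 n β = 2 ^ (n - 3) := by
  obtain ⟨m, rfl⟩ : ∃ m, n = m + 3 := ⟨n - 3, by omega⟩
  have hβ' : ∀ i < m + 2, β i = 1 / 2 := by
    intro i hi
    rcases hβ with rfl | rfl <;> simp [halfSpinWeight, negLast] <;> grind
  have hlast : β (m + 2) = 1 / 2 ∨ β (m + 2) = -(1 / 2) := by
    rcases hβ with rfl | rfl <;> simp [halfSpinWeight, negLast]
  have := soEvenDim_halfSpin (m := m) (γ := fun i => β (2 + i)) (fun i hi => hβ' _ (by omega))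
    (by rwa [add_comm 2 m])
  rw [ogrEvenRank, slDim_two, hβ' 0 (by omega), hβ' 1 (by omega),
    show m + 3 - 2 = m + 1 by omega, this]
  simp

theorem ogrEvenDex_two_of_halfSpin {n : ℕ} (hn : 4 ≤ n) {β : ℕ → ℚ}
    (hβ : β = halfSpinWeight n ∨ β = negLast n (halfSpinWeight n)) :
    ogrEvenDex 2 n β = 2 ^ (n - 3) / 2 := by
  have hβ' : ∀ i < 2, β i = 1 / 2 := by
    intro i hi
    rcases hβ with rfl | rfl <;> simp [halfSpinWeight, negLast] <;> grind
  rw [ogrEvenDex, ogrEvenRank_two_of_halfSpin hn hβ, headSum_two, hβ' 0 (by omega),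
    hβ' 1 (by omega)]
  ring

theorem ogrEvenRank_two_lw (n : ℕ) (a b : ℚ) : ogrEvenRank 2 n (lw [a, b]) = a - b + 1 := by
  rw [ogrEvenRank, slDim_two, soEvenDim_of_eq_zero fun i _ => by simp [lw, add_comm 2 i]]
  simp [lw]

theorem ogrEvenDex_two_lw (n : ℕ) (a b : ℚ) :
    ogrEvenDex 2 n (lw [a, b]) = (a + b) / 2 * (a - b + 1) := by
  rw [ogrEvenDex, ogrEvenRank_two_lw, headSum_two]
  simp [lw]

theorem lw_append_zero (a : ℚ) : lw [a, 0] = lw [a] := by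
  funext i
  match i with
  | 0 => simp [lw]
  | 1 => simp [lw]
  | i + 2 => simp [lw]

theorem negLast_lw {n : ℕ} (hn : 3 ≤ n) (a b : ℚ) : negLast n (lw [a, b]) = lw [a, b] := by
  funext i
  by_cases hi : i = n - 1
  · obtain ⟨r, rfl⟩ : ∃ r, i = r + 2 := ⟨i - 2, by omega⟩
    simp [negLast, lw]
  · simp [negLast, hi]

theorem negLast_negLast (n : ℕ) (β : ℕ → ℚ) : negLast n (negLast n β) = β := by
  funext i
  by_cases hi : i = n - 1 <;> simp [negLast, hi]

/-- A weight of the form `(a, b, 0, …, 0)` with `a ≥ b ≥ 0` and `a + b ≥ 2` integers. -/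
def IsTwoRowWeight (β : ℕ → ℚ) : Prop :=
  ∃ a b : ℤ, 0 ≤ b ∧ b ≤ a ∧ 2 ≤ a + b ∧ β = lw [(a : ℚ), (b : ℚ)]

theorem IsOGrEvenWeight.eq_halfSpin_or_isTwoRow {n : ℕ} (hn : 5 ≤ n) {β : ℕ → ℚ}
    (hβ : IsOGrEvenWeight n β) (hne : β ≠ 0) (hne' : β ≠ lw [1])
    (hexcess : 2 * ogrEvenDex 2 n β - ogrEvenRank 2 n β ≤ 5) :
    (β = halfSpinWeight n ∨ β = negLast n (halfSpinWeight n)) ∨ IsTwoRowWeight β := by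
  have hdom := hβ.isDominant
  have h10 := (le_abs_self _).trans (hdom 0 1 (by omega) (by omega))
  have htail : IsDominant (n - 2) fun i => β (2 + i) := by
    rw [← Nat.add_sub_cancel' (show 2 ≤ n by omega)] at hdom
    exact hdom.shift
  have hE1 := one_le_soEvenDim htail
  have hexcess' : (β 0 + β 1 - 1) * (β 0 - β 1 + 1) *
      soEvenDim (n - 2) (fun i => β (2 + i)) ≤ 5 := by
    rw [ogrEvenDex, ogrEvenRank, slDim_two, headSum_two] at hexcess
    refine le_trans (le_of_eq ?_) hexcess
    push_cast
    ring
  rcases hβ.1 with hint | hhalf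
  · right
    have hadd := hβ.two_le_add (by omega) hint hne hne'
    have hzero : ∀ i < n - 2, β (2 + i) = 0 := by
      by_contra! hcon
      have hE := two_mul_le_soEvenDim (by omega) htail (fun i hi => hint _ (by omega)) hcon
      have hn3 : (3 : ℚ) ≤ (n - 2 : ℕ) := by exact_mod_cast (by omega : 3 ≤ n - 2)
      have hst : 1 ≤ (β 0 + β 1 - 1) * (β 0 - β 1 + 1) :=
        one_le_mul_of_one_le_of_one_le (by linarith) (by linarith)
      nlinarith
    obtain ⟨a, ha⟩ := hint 0 (by omega)
    obtain ⟨b, hb⟩ := hint 1 (by omega)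
    have h1 := hβ.nonneg (i := 1) (by omega)
    rw [ha, hb] at h10 hadd
    rw [hb] at h1
    refine ⟨a, b, by exact_mod_cast h1, by exact_mod_cast h10, by exact_mod_cast hadd,
      funext fun i => ?_⟩
    match i with
    | 0 => simp [lw, ha]
    | 1 => simp [lw, hb]
    | i + 2 =>
      rcases lt_or_ge (i + 2) n with hi | hi
      · have := hzero i (by omega)
        rw [add_comm] at this
        simp [lw, this]
      · simp [lw, hβ.2.2.2 _ hi]
  · left
    have hle := fun i (hi : i + 1 < n) => hβ.half_le hhalf hi
    have h0 : β 0 = 1 / 2 := by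
      obtain ⟨z, hz⟩ := hhalf 0 (by omega)
      have hz0 : 0 ≤ z := by
        have := hle 0 (by omega)
        rw [hz] at this
        have : (0 : ℚ) ≤ z := by linarith
        exact_mod_cast this
      rcases hz0.eq_or_lt with rfl | hz1
      · simp [hz]
      · exfalso
        have hz1' : (1 : ℚ) ≤ z := by exact_mod_cast hz1
        have hE : (4 : ℚ) ≤ soEvenDim (n - 2) fun i => β (2 + i) := by
          obtain ⟨m, rfl⟩ : ∃ m, n = m + 5 := ⟨n - 5, by omega⟩
          refine le_trans ?_ (two_pow_le_soEvenDim (m := m + 2) htail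
            fun i hi => hle _ (by omega))
          have : (1 : ℚ) ≤ 2 ^ m := one_le_pow₀ (by norm_num)
          rw [pow_add]
          linarith
        have h1 := hle 1 (by omega)
        have hst : 2 ≤ (β 0 + β 1 - 1) * (β 0 - β 1 + 1) := by
          nlinarith [mul_nonneg (show 0 ≤ β 0 + β 1 - 2 by linarith) (sub_nonneg.2 h10)]
        nlinarith
    have hmid : ∀ i, i + 1 < n → β i = 1 / 2 := fun i hi =>
      le_antisymm (h0 ▸ hβ.2.1 0 i (Nat.zero_le i) hi) (hle i hi)
    have hlast : β (n - 1) = 1 / 2 ∨ β (n - 1) = -(1 / 2) := by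
      have h := h0 ▸ hdom 0 (n - 1) (by omega) (by omega)
      obtain ⟨z, hz⟩ := hhalf (n - 1) (by omega)
      rw [hz, abs_le] at h
      have h1 : (-1 : ℚ) ≤ z := by linarith
      have h2 : (z : ℚ) ≤ 0 := by linarith
      have h1' : -1 ≤ z := by exact_mod_cast h1
      have h2' : z ≤ 0 := by exact_mod_cast h2
      rcases (show z = 0 ∨ z = -1 by omega) with rfl | rfl
      · left; rw [hz]; norm_num
      · right; rw [hz]; norm_num
    refine hlast.imp (fun hl => ?_) fun hl => ?_
    all_goals
      funext i
      rcases (show i + 1 < n ∨ i = n - 1 ∨ n ≤ i by omega) with hi | rfl | hi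
    · simp [halfSpinWeight, hmid i hi, show i < n by omega]
    · simp [halfSpinWeight, hl, show n - 1 < n by omega]
    · simp [halfSpinWeight, hβ.2.2.2 i hi, show ¬ i < n by omega]
    · simp [halfSpinWeight, negLast, hmid i hi, show i < n by omega, show i ≠ n - 1 by omega]
    · simp [halfSpinWeight, negLast, hl, show n - 1 < n by omega]
    · simp [halfSpinWeight, negLast, hβ.2.2.2 i hi, show ¬ i < n by omega]

theorem Multiset.exists_eq_replicate_add_replicate {α : Type*} {u v : α} {S : Multiset α}
    (h : ∀ x ∈ S, x = u ∨ x = v) :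
    ∃ i j, S = Multiset.replicate i u + Multiset.replicate j v := by
  induction S using Multiset.induction with
  | empty => exact ⟨0, 0, rfl⟩
  | cons x S ih =>
    obtain ⟨i, j, rfl⟩ := ih fun y hy => h y (Multiset.mem_cons_of_mem hy)
    rcases h x (Multiset.mem_cons_self _ _) with rfl | rfl
    · exact ⟨i + 1, j, by rw [Multiset.replicate_succ, Multiset.cons_add]⟩
    · exact ⟨i, j + 1, by rw [Multiset.replicate_succ, Multiset.add_cons]⟩

theorem Multiset.le_sum_map_of_mem {α : Type*} {S : Multiset α} {f : α → ℚ}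
    (hf : ∀ x ∈ S, 0 ≤ f x) {x : α} (hx : x ∈ S) : f x ≤ (S.map f).sum :=
  Multiset.single_le_sum (by simpa using hf) _ (Multiset.mem_map_of_mem f hx)

theorem Multiset.mul_sum_map_le_sum_map {α : Type*} {S : Multiset α} {f g : α → ℚ} {c : ℚ}
    (h : ∀ x ∈ S, c * f x ≤ g x) : c * (S.map f).sum ≤ (S.map g).sum := by
  rw [← Multiset.sum_map_mul_left]
  exact Multiset.sum_map_le_sum_map _ _ h

theorem eq_of_sum_rank_eq_five (n : ℕ) {T : Multiset (ℕ → ℚ)} (hT : ∀ β ∈ T, IsTwoRowWeight β)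
    (hr : (T.map (ogrEvenRank 2 n)).sum = 5) (hd : (T.map (ogrEvenDex 2 n)).sum = 5) :
    T = Multiset.replicate 5 (lw [1, 1]) ∨ T = {lw [2], lw [1, 1], lw [1, 1]} := by
  have hdiff : (T.map fun β => ogrEvenDex 2 n β - ogrEvenRank 2 n β).sum = 0 := by
    rw [Multiset.sum_map_sub, hr, hd, sub_self]
  have hval : ∀ a b : ℚ, ogrEvenDex 2 n (lw [a, b]) - ogrEvenRank 2 n (lw [a, b]) =
      (a + b - 2) / 2 * (a - b + 1) := fun a b => by
    rw [ogrEvenDex_two_lw, ogrEvenRank_two_lw]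
    ring
  have hnonneg : ∀ β ∈ T, 0 ≤ ogrEvenDex 2 n β - ogrEvenRank 2 n β := by
    intro β hβ
    obtain ⟨a, b, hb, hba, hab, rfl⟩ := hT β hβ
    have hba' : (b : ℚ) ≤ a := by exact_mod_cast hba
    have hab' : (2 : ℚ) ≤ a + b := by exact_mod_cast hab
    rw [hval]
    exact mul_nonneg (by linarith) (by linarith)
  have hmem : ∀ β ∈ T, β = lw [1, 1] ∨ β = lw [2] := by
    intro β hβ
    have hle := Multiset.le_sum_map_of_mem hnonneg hβ
    obtain ⟨a, b, hb, hba, hab, rfl⟩ := hT β hβ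
    have hba' : (b : ℚ) ≤ a := by exact_mod_cast hba
    rw [hdiff, hval] at hle
    have h2 : (a : ℚ) + b ≤ 2 := by nlinarith
    have h2' : a + b ≤ 2 := by exact_mod_cast h2
    rcases (show a = 1 ∧ b = 1 ∨ a = 2 ∧ b = 0 by omega) with ⟨rfl, rfl⟩ | ⟨rfl, rfl⟩
    · left; norm_num
    · right; simpa using lw_append_zero 2
  obtain ⟨i, j, rfl⟩ := Multiset.exists_eq_replicate_add_replicate hmem
  rw [← lw_append_zero 2] at hr
  simp only [Multiset.map_add, Multiset.map_replicate, Multiset.sum_add, Multiset.sum_replicate,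
    ogrEvenRank_two_lw, nsmul_eq_mul] at hr
  have hij : i + 3 * j = 5 := by
    have : (i : ℚ) + 3 * j = 5 := by linarith
    exact_mod_cast this
  rcases (show i = 5 ∧ j = 0 ∨ i = 2 ∧ j = 1 by omega) with ⟨rfl, rfl⟩ | ⟨rfl, rfl⟩
  · left; simp
  · right
    rw [add_comm]
    rfl

theorem eq_of_sum_rank_eq_one (n : ℕ) {T : Multiset (ℕ → ℚ)} (hT : ∀ β ∈ T, IsTwoRowWeight β)
    (hr : (T.map (ogrEvenRank 2 n)).sum = 1) (hd : (T.map (ogrEvenDex 2 n)).sum = 3) :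
    T = {lw [3, 3]} := by
  have hcard : T.card = 1 := by
    refine le_antisymm ?_ (Multiset.card_pos.mpr fun h => by simp [h] at hr)
    have h := Multiset.sum_map_le_sum_map (s := T) (fun _ => (1 : ℚ)) (ogrEvenRank 2 n)
      fun β hβ => by
        obtain ⟨a, b, hb, hba, hab, rfl⟩ := hT β hβ
        have hba' : (b : ℚ) ≤ a := by exact_mod_cast hba
        rw [ogrEvenRank_two_lw]
        linarith
    rw [hr] at h
    simpa using h
  obtain ⟨β, rfl⟩ := Multiset.card_eq_one.mp hcard
  obtain ⟨a, b, hb, hba, hab, rfl⟩ := hT β (by simp)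
  simp only [Multiset.map_singleton, Multiset.sum_singleton, ogrEvenRank_two_lw,
    ogrEvenDex_two_lw] at hr hd
  rw [hr] at hd
  have ha3 : (a : ℚ) = 3 := by linarith
  have hb3 : (b : ℚ) = 3 := by linarith
  rw [ha3, hb3]

theorem halfSpinWeight_five : halfSpinWeight 5 = lw [1/2, 1/2, 1/2, 1/2, 1/2] := by
  funext i
  match i with
  | 0 | 1 | 2 | 3 | 4 => simp [halfSpinWeight, lw]
  | i + 5 => simp [halfSpinWeight, lw]

theorem negLast_halfSpinWeight_five :
    negLast 5 (halfSpinWeight 5) = lw [1/2, 1/2, 1/2, 1/2, -(1/2)] := by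
  funext i
  match i with
  | 0 | 1 | 2 | 3 | 4 => simp [halfSpinWeight, negLast, lw]
  | i + 5 => simp [halfSpinWeight, negLast, lw]

theorem halfSpinWeight_six : halfSpinWeight 6 = lw [1/2, 1/2, 1/2, 1/2, 1/2, 1/2] := by
  funext i
  match i with
  | 0 | 1 | 2 | 3 | 4 | 5 => simp [halfSpinWeight, lw]
  | i + 6 => simp [halfSpinWeight, lw]

theorem halfSpinWeight_seven :
    halfSpinWeight 7 = lw [1/2, 1/2, 1/2, 1/2, 1/2, 1/2, 1/2] := by
  funext i
  match i with
  | 0 | 1 | 2 | 3 | 4 | 5 | 6 => simp [halfSpinWeight, lw]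
  | i + 7 => simp [halfSpinWeight, lw]

theorem IsTwoRowWeight.negLast_eq {n : ℕ} (hn : 3 ≤ n) {β : ℕ → ℚ} (h : IsTwoRowWeight β) :
    negLast n β = β := by
  obtain ⟨a, b, -, -, -, rfl⟩ := h
  exact negLast_lw hn _ _

theorem IsTwoRowWeight.not_new {n : ℕ} {β : ℕ → ℚ} (h : IsTwoRowWeight β)
    (hnew : (∃ i, i < n ∧ ∀ z : ℤ, β i ≠ (z : ℚ)) ∨ ∃ j, 2 ≤ j ∧ j < n ∧ β j ≠ 0) : False := by
  obtain ⟨a, b, -, -, -, rfl⟩ := h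
  rcases hnew with ⟨i, -, hi⟩ | ⟨j, hj, -, hj0⟩
  · match i with
    | 0 => exact hi a rfl
    | 1 => exact hi b rfl
    | i + 2 => exact hi 0 (by simp [lw])
  · obtain ⟨r, rfl⟩ : ∃ r, j = r + 2 := ⟨j - 2, by omega⟩
    exact hj0 (by simp [lw])

/-- Decomposition, for `k = 2`, into `s` and `t` copies of the two half-spin weights and
weights of the form `(a, b, 0, …, 0)`. -/
theorem exists_decomposition_two {n : ℕ} (hn : 5 ≤ n) {S : Multiset (ℕ → ℚ)}
    (hw : ∀ β ∈ S, IsOGrEvenWeight n β ∧ β ≠ 0 ∧ β ≠ lw [1])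
    (hnew : ∃ β ∈ S,
      (∃ i, i < n ∧ ∀ z : ℤ, β i ≠ (z : ℚ)) ∨ ∃ j, 2 ≤ j ∧ j < n ∧ β j ≠ 0)
    (hr : (S.map (ogrEvenRank 2 n)).sum = 4 * (n : ℚ) - 11)
    (hd : (S.map (ogrEvenDex 2 n)).sum = 2 * (n : ℚ) - 3) :
    ∃ s t : ℕ, 1 ≤ s + t ∧ ∃ T : Multiset (ℕ → ℚ), (∀ β ∈ T, IsTwoRowWeight β) ∧
      S = Multiset.replicate s (halfSpinWeight n) +
        Multiset.replicate t (negLast n (halfSpinWeight n)) + T ∧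
      ((s : ℚ) + t) * 2 ^ (n - 3) + (T.map (ogrEvenRank 2 n)).sum = 4 * (n : ℚ) - 11 ∧
      2 * (T.map (ogrEvenDex 2 n)).sum - (T.map (ogrEvenRank 2 n)).sum = 5 := by
  classical
  have hnonneg : ∀ β ∈ S, 0 ≤ 2 * ogrEvenDex 2 n β - ogrEvenRank 2 n β := fun β hβ => by
    obtain ⟨h1, h2, h3⟩ := hw β hβ
    have := h1.slope_ge le_rfl (by omega) h2 h3 (c := 1 / 2) le_rfl (by norm_num)
    linarith
  have hclass : ∀ β ∈ S, (β = halfSpinWeight n ∨ β = negLast n (halfSpinWeight n)) ∨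
      IsTwoRowWeight β := fun β hβ => by
    obtain ⟨h1, h2, h3⟩ := hw β hβ
    refine h1.eq_halfSpin_or_isTwoRow hn h2 h3
      ((Multiset.le_sum_map_of_mem hnonneg hβ).trans (le_of_eq ?_))
    rw [Multiset.sum_map_sub, Multiset.sum_map_mul_left, hr, hd]
    ring
  obtain ⟨s, t, hst⟩ := Multiset.exists_eq_replicate_add_replicate
    (u := halfSpinWeight n) (v := negLast n (halfSpinWeight n))
    (S := S.filter fun β => β = halfSpinWeight n ∨ β = negLast n (halfSpinWeight n))
    fun β hβ => (Multiset.mem_filter.mp hβ).2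
  have hS := Multiset.filter_add_not
    (fun β => β = halfSpinWeight n ∨ β = negLast n (halfSpinWeight n)) S
  set T := S.filter fun β => ¬(β = halfSpinWeight n ∨ β = negLast n (halfSpinWeight n)) with hTdef
  have hT : ∀ β ∈ T, IsTwoRowWeight β := fun β hβ =>
    (hclass β (Multiset.mem_filter.mp hβ).1).resolve_left (Multiset.mem_filter.mp hβ).2
  rw [hst] at hS
  rw [← hS] at hr hd
  simp only [Multiset.map_add, Multiset.map_replicate, Multiset.sum_add, Multiset.sum_replicate,
    ogrEvenRank_two_of_halfSpin (show 4 ≤ n by omega) (Or.inl rfl),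
    ogrEvenRank_two_of_halfSpin (show 4 ≤ n by omega) (Or.inr rfl),
    ogrEvenDex_two_of_halfSpin (show 4 ≤ n by omega) (Or.inl rfl),
    ogrEvenDex_two_of_halfSpin (show 4 ≤ n by omega) (Or.inr rfl), nsmul_eq_mul] at hr hd
  refine ⟨s, t, ?_, T, hT, hS.symm, by linarith, by linarith⟩
  obtain ⟨β, hβ, hβnew⟩ := hnew
  by_contra! hlt
  obtain ⟨rfl, rfl⟩ : s = 0 ∧ t = 0 := by omega
  rw [← hS] at hβ
  simp only [Multiset.replicate_zero, zero_add] at hβ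
  exact (hT β hβ).not_new hβnew

theorem not_three_le {n k : ℕ} (hk : 3 ≤ k) (hkn : k + 3 ≤ n) {S : Multiset (ℕ → ℚ)}
    (hw : ∀ β ∈ S, IsOGrEvenWeight n β ∧ β ≠ 0 ∧ β ≠ lw [1])
    (hr : (S.map (ogrEvenRank k n)).sum =
      (k : ℚ) * (2 * (n : ℚ) - (k : ℚ)) - (k : ℚ) * ((k : ℚ) + 1) / 2 - 4)
    (hd : (S.map (ogrEvenDex k n)).sum = 2 * (n : ℚ) - (k : ℚ) - 1) : False := by
  have hslope : ∀ c : ℚ, c ≤ 1 / 2 → c * k ≤ 2 →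
      c * ((k : ℚ) * (2 * (n : ℚ) - (k : ℚ)) - (k : ℚ) * ((k : ℚ) + 1) / 2 - 4) ≤
        2 * (n : ℚ) - (k : ℚ) - 1 := fun c hc hck => by
    rw [← hr, ← hd]
    refine Multiset.mul_sum_map_le_sum_map fun β hβ => ?_
    obtain ⟨h1, h2, h3⟩ := hw β hβ
    exact h1.slope_ge (by omega) (by omega) h2 h3 hc hck
  have hn : (k : ℚ) + 3 ≤ n := by exact_mod_cast hkn
  rcases hk.eq_or_lt with rfl | hk4
  · have := hslope (1 / 2) le_rfl (by norm_num)
    push_cast at this hn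
    linarith
  · have hk4' : (4 : ℚ) ≤ k := by exact_mod_cast hk4
    have hk0 : (0 : ℚ) < k := by linarith
    have := hslope (2 / k) (by rw [div_le_div_iff₀ hk0 two_pos]; linarith)
      (by rw [div_mul_cancel₀ _ hk0.ne'])
    rw [div_mul_eq_mul_div, div_le_iff₀ hk0] at this
    nlinarith

theorem lt_sum_rank_one {n : ℕ} (hn : 4 ≤ n) {S : Multiset (ℕ → ℚ)}
    (hw : ∀ β ∈ S, IsOGrEvenWeight n β)
    (hnew : ∃ β ∈ S,
      (∃ i, i < n ∧ ∀ z : ℤ, β i ≠ (z : ℚ)) ∨ ∃ j, 1 ≤ j ∧ j < n ∧ β j ≠ 0) :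
    2 * (n : ℚ) - 6 < (S.map (ogrEvenRank 1 n)).sum := by
  obtain ⟨β, hβ, hβnew⟩ := hnew
  refine ((hw β hβ).rank_one_gt hn hβnew).trans_le (Multiset.le_sum_map_of_mem (fun γ hγ => ?_) hβ)
  exact zero_le_one.trans ((hw γ hγ).one_le_rank (by omega))

/-- Classification of fourfolds with trivial canonical bundle in even orthogonal
Grassmannians `OGr(k,2n)` with `k ≤ n−3`. -/
theorem stmt16 (n k : ℕ) (hk : 1 ≤ k) (hkn : k ≤ n - 3)
    (S : Multiset (ℕ → ℚ))
    (hw : ∀ β ∈ S, IsOGrEvenWeight n β ∧ β ≠ 0 ∧ β ≠ lw [1])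
    (hnew : ∃ β ∈ S,
      (∃ i, i < n ∧ ∀ z : ℤ, β i ≠ (z : ℚ)) ∨ ∃ j, k ≤ j ∧ j < n ∧ β j ≠ 0)
    (hr : (S.map (ogrEvenRank k n)).sum =
      (k : ℚ) * (2 * (n : ℚ) - (k : ℚ)) - (k : ℚ) * ((k : ℚ) + 1) / 2 - 4)
    (hd : (S.map (ogrEvenDex k n)).sum = 2 * (n : ℚ) - (k : ℚ) - 1) :
    k = 2 ∧ ∃ S', (S' = S ∨ S' = S.map (negLast n)) ∧
      ((n = 5 ∧ S' = {lw [1/2, 1/2, 1/2, 1/2, 1/2], lw [1/2, 1/2, 1/2, 1/2, 1/2],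
          lw [3, 3]}) ∨
       (n = 5 ∧ S' = {lw [1/2, 1/2, 1/2, 1/2, 1/2], lw [1/2, 1/2, 1/2, 1/2, -(1/2)],
          lw [3, 3]}) ∨
       (n = 5 ∧ S' = {lw [1/2, 1/2, 1/2, 1/2, 1/2]} +
          Multiset.replicate 5 (lw [1, 1])) ∨
       (n = 5 ∧ S' = {lw [1/2, 1/2, 1/2, 1/2, 1/2], lw [2], lw [1, 1], lw [1, 1]}) ∨
       (n = 6 ∧ S' = {lw [1/2, 1/2, 1/2, 1/2, 1/2, 1/2]} +
          Multiset.replicate 5 (lw [1, 1])) ∨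
       (n = 6 ∧ S' = {lw [1/2, 1/2, 1/2, 1/2, 1/2, 1/2], lw [2], lw [1, 1],
          lw [1, 1]}) ∨
       (n = 7 ∧ S' = {lw [1/2, 1/2, 1/2, 1/2, 1/2, 1/2, 1/2], lw [3, 3]})) := by
  have hkn' : k + 3 ≤ n := by omega
  obtain rfl : k = 2 := by
    rcases (show k = 1 ∨ k = 2 ∨ 3 ≤ k by omega) with rfl | rfl | hk3
    · have h := lt_sum_rank_one hkn' (fun β hβ => (hw β hβ).1) hnew
      rw [hr] at h
      push_cast at h
      linarith
    · rfl
    · exact (not_three_le hk3 hkn' hw hr hd).elim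
  refine ⟨rfl, ?_⟩
  obtain ⟨s, t, hst, T, hT, hS, hrank, hdex⟩ := exists_decomposition_two hkn' hw hnew
    (by rw [hr]; push_cast; ring) (by rw [hd]; push_cast; ring)
  have hTneg : T.map (negLast n) = T :=
    (Multiset.map_congr rfl fun β hβ => (hT β hβ).negLast_eq (by omega)).trans T.map_id'
  have hSneg : S.map (negLast n) = Multiset.replicate t (halfSpinWeight n) +
      Multiset.replicate s (negLast n (halfSpinWeight n)) + T := by
    rw [hS, Multiset.map_add, Multiset.map_add, hTneg, Multiset.map_replicate,
      Multiset.map_replicate, negLast_negLast, add_comm (Multiset.replicate s _)]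
  have hT0 : 0 ≤ (T.map (ogrEvenRank 2 n)).sum := by
    refine Multiset.sum_nonneg fun x hx => ?_
    obtain ⟨β, hβ, rfl⟩ := Multiset.mem_map.mp hx
    obtain ⟨a, b, hb, hba, hab, rfl⟩ := hT β hβ
    have hba' : (b : ℚ) ≤ a := by exact_mod_cast hba
    rw [ogrEvenRank_two_lw]
    linarith
  obtain ⟨S', hS'S, s, t, hts, hst, hS', hrank⟩ :
      ∃ S', (S' = S ∨ S' = S.map (negLast n)) ∧ ∃ s t : ℕ, t ≤ s ∧ 1 ≤ s + t ∧
        S' = Multiset.replicate s (halfSpinWeight n) +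
          Multiset.replicate t (negLast n (halfSpinWeight n)) + T ∧
        ((s : ℚ) + t) * 2 ^ (n - 3) + (T.map (ogrEvenRank 2 n)).sum = 4 * (n : ℚ) - 11 := by
    rcases le_total t s with h | h
    · exact ⟨S, Or.inl rfl, s, t, h, hst, hS, hrank⟩
    · exact ⟨_, Or.inr rfl, t, s, h, by omega, hSneg, by rw [add_comm (t : ℚ)]; exact hrank⟩
  refine ⟨S', hS'S, ?_⟩
  have hst' : (1 : ℚ) ≤ s + t := by exact_mod_cast hst
  have hn7 : n ≤ 7 := by
    by_contra! hn8
    obtain ⟨m, rfl⟩ : ∃ m, n = m + 8 := ⟨n - 8, by omega⟩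
    have hpow : (m : ℚ) + 1 ≤ 2 ^ m := by exact_mod_cast Nat.lt_two_pow_self
    rw [show m + 8 - 3 = m + 5 from rfl, pow_add] at hrank
    push_cast at hrank
    nlinarith
  have hfive : n = 5 ∨ n = 6 ∨ n = 7 := by omega
  rcases hfive with rfl | rfl | rfl
  · norm_num at hrank
    have hle : (s : ℚ) + t < 3 := by linarith
    have hle' : s + t < 3 := by exact_mod_cast hle
    rcases (show (s = 1 ∧ t = 0) ∨ (s = 2 ∧ t = 0) ∨ (s = 1 ∧ t = 1) by omega) with
      ⟨rfl, rfl⟩ | ⟨rfl, rfl⟩ | ⟨rfl, rfl⟩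
    · push_cast at hrank
      have hR : (T.map (ogrEvenRank 2 5)).sum = 5 := by linarith
      rcases eq_of_sum_rank_eq_five 5 hT hR (by linarith) with rfl | rfl
      · right; right; left
        exact ⟨rfl, by rw [hS', halfSpinWeight_five]; rfl⟩
      · right; right; right; left
        exact ⟨rfl, by rw [hS', halfSpinWeight_five]; rfl⟩
    · push_cast at hrank
      have hR : (T.map (ogrEvenRank 2 5)).sum = 1 := by linarith
      obtain rfl := eq_of_sum_rank_eq_one 5 hT hR (by linarith)
      left
      exact ⟨rfl, by rw [hS', halfSpinWeight_five]; rfl⟩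
    · push_cast at hrank
      have hR : (T.map (ogrEvenRank 2 5)).sum = 1 := by linarith
      obtain rfl := eq_of_sum_rank_eq_one 5 hT hR (by linarith)
      right; left
      exact ⟨rfl, by rw [hS', negLast_halfSpinWeight_five, halfSpinWeight_five]; rfl⟩
  · norm_num at hrank
    have hle : (s : ℚ) + t < 2 := by linarith
    have hle' : s + t < 2 := by exact_mod_cast hle
    obtain ⟨rfl, rfl⟩ : s = 1 ∧ t = 0 := by omega
    push_cast at hrank
    have hR : (T.map (ogrEvenRank 2 6)).sum = 5 := by linarith
    rcases eq_of_sum_rank_eq_five 6 hT hR (by linarith) with rfl | rfl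
    · right; right; right; right; left
      exact ⟨rfl, by rw [hS', halfSpinWeight_six]; rfl⟩
    · right; right; right; right; right; left
      exact ⟨rfl, by rw [hS', halfSpinWeight_six]; rfl⟩
  · norm_num at hrank
    have hle : (s : ℚ) + t < 2 := by linarith
    have hle' : s + t < 2 := by exact_mod_cast hle
    obtain ⟨rfl, rfl⟩ : s = 1 ∧ t = 0 := by omega
    push_cast at hrank
    have hR : (T.map (ogrEvenRank 2 7)).sum = 1 := by linarith
    obtain rfl := eq_of_sum_rank_eq_one 7 hT hR (by linarith)
    right; right; right; right; right; right
    exact ⟨rfl, by rw [hS', halfSpinWeight_seven]; rfl⟩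
end

section
/- (Classification of fourfolds with trivial canonical bundle in the maximal even orthogonal Grassmannians OGr(n,2n).) Let n ≥ 2 and let β¹, …, β^m be nonzero n-tuples with β₁ ≥ … ≥ β_{n−1} ≥ |β_n|, each with entries all integers or all half-odd-integers, such that: no β^i equals (1,0,…,0); at least one β^i has non-integer entries or has β^i_n < 0; ∑_i D_n(β^i) = n(n−1)/2 − 4; and ∑_i ((β^i₁ + … + β^i_n)/n) · D_n(β^i) = n − 1. Then, up to reordering and up to simultaneously replacing the last entry β^i_n by −β^i_n for every i, (n, (β¹,…,β^m)) is one of the following seven: (1) n=4: (1/2,1/2,1/2,1/2), (5/2,5/2,5/2,5/2); (2) n=4: (3/2,3/2,3/2,3/2) twice; (3) n=5: (1/2,1/2,1/2,1/2,−1/2), (5/2,5/2,5/2,5/2,5/2); (4) n=5: (1/2,1/2,1/2,1/2,1/2) four times, (1,1,1,1,1) twice; (5) n=5: (1/2,1/2,1/2,1/2,1/2) five times, (3/2,3/2,3/2,3/2,3/2); (6) n=5: (1/2,1/2,1/2,1/2,1/2), (3/2,1/2,1/2,1/2,1/2); (7) n=6: (1/2,1/2,1/2,1/2,1/2,−1/2),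 (1/2,1/2,1/2,1/2,1/2,1/2) four times, (1,1,1,1,1,1). -/
open Finset

lemma choose_two_le_choose {n k : ℕ} (hk : 2 ≤ k) (hkn : k + 2 ≤ n) :
    n.choose 2 ≤ n.choose k := by
  induction n generalizing k with
  | zero => omega
  | succ n ih =>
    rcases Nat.lt_or_ge n (k + 2) with h | h
    · obtain rfl : n = k + 1 := by omega
      exact (Nat.choose_symm_of_eq_add (by omega)).le
    · obtain ⟨k, rfl⟩ : ∃ l, k = l + 1 := ⟨k - 1, by omega⟩
      rw [Nat.choose_succ_succ' n k, Nat.choose_succ_succ' n 1]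
      refine Nat.add_le_add ?_ (ih hk h)
      rcases Nat.lt_or_ge k 2 with h2 | h2
      · obtain rfl : k = 1 := by omega
        rfl
      · refine le_trans ?_ (ih h2 (by omega))
        rw [Nat.choose_one_right, Nat.choose_two_right, Nat.le_div_iff_mul_le (by norm_num)]
        exact Nat.mul_le_mul_left n (by omega)

lemma prod_sub_div_sub (n k : ℕ) (h : k ≤ n) :
    ∏ i ∈ range k, ((n : ℚ) - i) / ((k : ℚ) - i) = n.choose k := by
  have cast_desc : ∀ m, k ≤ m → ∏ i ∈ range k, ((m : ℚ) - i) = m.descFactorial k := by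
    intro m hm
    rw [Nat.descFactorial_eq_prod_range, Nat.cast_prod]
    refine prod_congr rfl fun i hi => ?_
    rw [Nat.cast_sub ((mem_range.1 hi).le.trans hm)]
  rw [prod_div_distrib, cast_desc n h, cast_desc k le_rfl, Nat.descFactorial_self,
    Nat.descFactorial_eq_factorial_mul_choose, Nat.cast_mul,
    mul_div_cancel_left₀ _ (by exact_mod_cast k.factorial_ne_zero)]

lemma prod_le_slDim {n : ℕ} {β : ℕ → ℚ} {G : ℕ → ℕ → ℚ}
    (h0 : ∀ i j, i < j → j < n → 0 ≤ G i j)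
    (h : ∀ i j, i < j → j < n → G i j ≤ ((j : ℚ) - i + β i - β j) / ((j : ℚ) - i)) :
    ∏ i ∈ range n, ∏ j ∈ range n, (if i < j then G i j else 1) ≤ slDim n β := by
  refine prod_le_prod (fun i _ => prod_nonneg fun j hj => ?_) fun i _ =>
    prod_le_prod (fun j hj => ?_) fun j hj => ?_
  · split_ifs with hij
    exacts [h0 i j hij (mem_range.1 hj), zero_le_one]
  · split_ifs with hij
    exacts [h0 i j hij (mem_range.1 hj), zero_le_one]
  · split_ifs with hij
    exacts [h i j hij (mem_range.1 hj), le_rfl]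

lemma div_le_factor {i j : ℕ} (hij : i < j) {β : ℕ → ℚ} {c : ℚ} (h : c ≤ β i - β j) :
    ((j : ℚ) - i + c) / ((j : ℚ) - i) ≤ ((j : ℚ) - i + β i - β j) / ((j : ℚ) - i) := by
  have : (0 : ℚ) < (j : ℚ) - i := sub_pos.2 (by exact_mod_cast hij)
  gcongr
  linarith

lemma one_le_factor {i j : ℕ} (hij : i < j) {β : ℕ → ℚ} (h : β j ≤ β i) :
    1 ≤ ((j : ℚ) - i + β i - β j) / ((j : ℚ) - i) := by
  have h1 : (0 : ℚ) < (j : ℚ) - i := sub_pos.2 (by exact_mod_cast hij)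
  rw [le_div_iff₀ h1]
  linarith

lemma factor_nonneg {i j : ℕ} (hij : i < j) {c : ℚ} (h : 0 ≤ c) :
    0 ≤ ((j : ℚ) - i + c) / ((j : ℚ) - i) := by
  have h1 : (0 : ℚ) < (j : ℚ) - i := sub_pos.2 (by exact_mod_cast hij)
  positivity

lemma one_le_slDim_s18 {n : ℕ} {β : ℕ → ℚ} (hβ : ∀ i j, i ≤ j → j < n → β j ≤ β i) :
    1 ≤ slDim n β := by
  refine le_trans (le_of_eq ?_) (prod_le_slDim (G := fun _ _ => 1) (fun _ _ _ _ => zero_le_one)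
    fun i j hij hj => one_le_factor hij (hβ i j hij.le hj))
  simp

lemma prod_range_telescope (a : ℚ) (ha : 0 < a) (m : ℕ) :
    ∏ x ∈ range m, (a + x + 1) / (a + x) = (a + m) / a := by
  induction m with
  | zero => simp [ha.ne']
  | succ m ih =>
    have : a + m ≠ 0 := by positivity
    rw [prod_range_succ, ih]
    push_cast
    field_simp
    ring

/-- A unit gap after position `k` forces the dimension of the `k`-th exterior power. -/
lemma choose_le_slDim {n k : ℕ} {β : ℕ → ℚ} (hβ : ∀ i j, i ≤ j → j < n → β j ≤ β i)
    (hk : 1 ≤ k) (hkn : k < n) (hgap : 1 ≤ β (k - 1) - β k) :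
    (n.choose k : ℚ) ≤ slDim n β := by
  refine le_trans (le_of_eq ?_) (prod_le_slDim
    (G := fun i j => if i < k ∧ k ≤ j then ((j : ℚ) - i + 1) / ((j : ℚ) - i) else 1) ?_ ?_)
  · obtain ⟨m, rfl⟩ := Nat.exists_eq_add_of_le hkn.le
    rw [← prod_sub_div_sub _ _ hkn.le, prod_range_add _ k m]
    have hrest : ∏ x ∈ range m, ∏ j ∈ range (k + m), (if k + x < j then
        (if k + x < k ∧ k ≤ j then ((j : ℚ) - ((k + x : ℕ) : ℚ) + 1) / ((j : ℚ) - ((k + x : ℕ) : ℚ))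
          else 1) else 1) = 1 := by
      refine prod_eq_one fun x _ => prod_eq_one fun j _ => ?_
      simp
    rw [hrest, mul_one]
    refine prod_congr rfl fun i hi => ?_
    have hik : i < k := mem_range.1 hi
    have hik' : (0 : ℚ) < (k : ℚ) - i := sub_pos.2 (by exact_mod_cast hik)
    rw [prod_range_add, prod_eq_one, one_mul]
    · have := prod_range_telescope _ hik' m
      push_cast
      rw [show (k : ℚ) + m - i = k - i + m by ring, ← this]
      refine prod_congr rfl fun x _ => ?_
      rw [if_pos (by omega), if_pos (by omega)]
      congr 1 <;> ring
    · intro j hj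
      have : ¬ (i < k ∧ k ≤ j) := by have := mem_range.1 hj; omega
      simp [this]
  · intro i j hij hj
    split_ifs
    exacts [factor_nonneg hij zero_le_one, zero_le_one]
  · intro i j hij hj
    split_ifs with h
    · refine div_le_factor hij ?_
      have h1 := hβ i (k - 1) (by omega) (by omega)
      have h2 := hβ k j h.2 hj
      linarith
    · exact one_le_factor hij (hβ i j hij.le hj)

lemma prod_range_two_step (m : ℕ) :
    ∏ x ∈ range m, ((x : ℚ) + 3) / ((x : ℚ) + 1) = ((m : ℚ) + 1) * (m + 2) / 2 := by
  induction m with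
  | zero => norm_num
  | succ m ih =>
    rw [prod_range_succ, ih]
    push_cast
    field_simp
    ring

/-- A first gap of size two forces the dimension of the symmetric square. -/
lemma symm_sq_le_slDim {m : ℕ} {β : ℕ → ℚ} (hβ : ∀ i j, i ≤ j → j < m + 1 → β j ≤ β i)
    (hgap : 2 ≤ β 0 - β 1) :
    ((m : ℚ) + 1) * (m + 2) / 2 ≤ slDim (m + 1) β := by
  refine le_trans (le_of_eq ?_) (prod_le_slDim
    (G := fun i j => if i = 0 then ((j : ℚ) - i + 2) / ((j : ℚ) - i) else 1) ?_ ?_)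
  · rw [prod_range_succ', prod_eq_one, one_mul, prod_range_succ', ← prod_range_two_step]
    · simp only [Nat.zero_lt_succ, if_true, lt_irrefl, if_false, mul_one]
      refine prod_congr rfl fun x _ => ?_
      push_cast
      congr 1 <;> ring
    · intro x _
      simp
  · intro i j hij hj
    split_ifs
    exacts [factor_nonneg hij zero_le_two, zero_le_one]
  · intro i j hij hj
    split_ifs with h
    · subst h
      refine div_le_factor hij ?_
      have h2 := hβ 1 j hij hj
      linarith
    · exact one_le_factor hij (hβ i j hij.le hj)

lemma slDim_dual (n : ℕ) (β : ℕ → ℚ) :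
    slDim n (fun i => -β (n - 1 - i)) = slDim n β := by
  unfold slDim
  rw [← prod_range_reflect, prod_comm, ← prod_range_reflect]
  refine prod_congr rfl fun i hi => prod_congr rfl fun j hj => ?_
  have hi := mem_range.1 hi
  have hj := mem_range.1 hj
  have e1 : n - 1 - (n - 1 - i) = i := by omega
  have e2 : n - 1 - (n - 1 - j) = j := by omega
  simp only [e1, e2]
  by_cases h : i < j
  · have cast_rev : ∀ x < n, ((n - 1 - x : ℕ) : ℚ) = n - 1 - x := fun x hx => by
      rw [Nat.sub_sub, Nat.cast_sub (by omega)]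
      push_cast
      ring
    rw [if_pos h, if_pos (by omega), cast_rev i hi, cast_rev j hj]
    congr 1 <;> ring
  · rw [if_neg h, if_neg (by omega)]

/-- Nonzero first and last gaps force a dimension of at least `n (n - 1)`. -/
lemma adjoint_le_slDim {m : ℕ} {β : ℕ → ℚ} (hβ : ∀ i j, i ≤ j → j < m + 2 → β j ≤ β i)
    (h1 : 1 ≤ β 0 - β 1) (h2 : 1 ≤ β m - β (m + 1)) :
    ((m : ℚ) + 2) * (m + 1) ≤ slDim (m + 2) β := by
  refine le_trans (le_of_eq ?_) (prod_le_slDim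
    (G := fun i j => if i = 0 ∨ j = m + 1 then ((j : ℚ) - i + 1) / ((j : ℚ) - i) else 1) ?_ ?_)
  · rw [prod_range_succ', mul_comm]
    congr 1
    · have := prod_sub_div_sub (m + 1) m (by omega)
      rw [Nat.choose_succ_self_right] at this
      push_cast at this
      rw [← this, prod_range_succ, prod_eq_one (s := range (m + 2)), mul_one]
      · refine prod_congr rfl fun i hi => ?_
        have := mem_range.1 hi
        rw [prod_range_succ, prod_eq_one, one_mul, if_pos (by omega), if_pos (Or.inr rfl)]
        · push_cast
          congr 1 <;> ring
        · intro j hj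
          have := mem_range.1 hj
          rw [if_neg (c := i + 1 = 0 ∨ j = m + 1) (by omega), ite_self]
      · intro j hj
        have := mem_range.1 hj
        rw [if_neg (by omega)]
    · rw [prod_range_succ']
      have := prod_range_telescope 1 one_pos (m + 1)
      simp only [Nat.zero_lt_succ, if_true, lt_irrefl, if_false, mul_one, true_or]
      push_cast at this ⊢
      rw [show (m : ℚ) + 2 = (1 + (m + 1)) / 1 by ring, ← this]
      refine prod_congr rfl fun x _ => ?_
      congr 1 <;> ring
  · intro i j hij hj
    split_ifs
    exacts [factor_nonneg hij zero_le_one, zero_le_one]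
  · intro i j hij hj
    split_ifs with h
    · refine div_le_factor hij ?_
      rcases h with rfl | rfl
      · have := hβ 1 j hij hj
        linarith
      · have := hβ i m (by omega) (by omega)
        linarith
    · exact one_le_factor hij (hβ i j hij.le hj)

/-- The weight of the line bundle `O(t)`. -/
def lineWt (n : ℕ) (t : ℚ) : ℕ → ℚ := fun i => if i < n then t else 0

/-- The weight of the twist by `O(t)` of the standard bundle of rank `n`. -/
def stdWt (n : ℕ) (t : ℚ) : ℕ → ℚ := fun i => if i = 0 then t + 1 else if i < n then t else 0

/-- The weight of the twist by `O(t)` of the dual of the standard bundle of rank `n`. -/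
def dualWt (n : ℕ) (t : ℚ) : ℕ → ℚ := fun i =>
  if i + 1 < n then t else if i + 1 = n then t - 1 else 0

lemma IsOGrEvenWeight.antitone {n : ℕ} {β : ℕ → ℚ} (h : IsOGrEvenWeight n β) :
    ∀ i j, i ≤ j → j < n → β j ≤ β i := by
  intro i j hij hj
  rcases hij.eq_or_lt with rfl | hlt
  · rfl
  rcases Nat.lt_or_ge (j + 1) n with h' | h'
  · exact h.2.1 i j hij h'
  · obtain rfl : j = n - 1 := by omega
    exact (le_abs_self _).trans (h.2.2.1 i (by omega))

lemma IsOGrEvenWeight.exists_nat_sub {n : ℕ} {β : ℕ → ℚ} (h : IsOGrEvenWeight n β) {i j : ℕ}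
    (hij : i ≤ j) (hj : j < n) : ∃ k : ℕ, β i - β j = k := by
  have : ∃ z : ℤ, β i - β j = z := by
    rcases h.1 with h | h
    · obtain ⟨a, ha⟩ := h i (by omega)
      obtain ⟨b, hb⟩ := h j hj
      exact ⟨a - b, by rw [ha, hb]; push_cast; ring⟩
    · obtain ⟨a, ha⟩ := h i (by omega)
      obtain ⟨b, hb⟩ := h j hj
      exact ⟨a - b, by rw [ha, hb]; push_cast; ring⟩
  obtain ⟨z, hz⟩ := this
  have h0 := h.antitone i j hij hj
  have : 0 ≤ z := by
    have : (0 : ℚ) ≤ z := by linarith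
    exact_mod_cast this
  obtain ⟨k, rfl⟩ := Int.eq_ofNat_of_zero_le this
  exact ⟨k, by simpa using hz⟩

lemma IsOGrEvenWeight.exists_half {n : ℕ} {β : ℕ → ℚ} (h : IsOGrEvenWeight n β) {i : ℕ}
    (hi : i + 1 < n) : ∃ k : ℕ, β i = k / 2 := by
  have : ∃ z : ℤ, β i = z / 2 := by
    rcases h.1 with h | h
    · obtain ⟨a, ha⟩ := h i (by omega)
      exact ⟨2 * a, by rw [ha]; push_cast; ring⟩
    · obtain ⟨a, ha⟩ := h i (by omega)
      exact ⟨2 * a + 1, by rw [ha]; push_cast; ring⟩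
  obtain ⟨z, hz⟩ := this
  have h0 := (abs_nonneg _).trans (h.2.2.1 i hi)
  have : 0 ≤ z := by
    have : (0 : ℚ) ≤ z := by linarith
    exact_mod_cast this
  obtain ⟨k, rfl⟩ := Int.eq_ofNat_of_zero_le this
  exact ⟨k, by simpa using hz⟩

/-- The irreducible bundles of rank less than `n (n - 1) / 2` are the line bundles and the twists
of the standard bundle and its dual. -/
lemma eq_of_slDim_lt {n : ℕ} (hn : 4 ≤ n) {β : ℕ → ℚ} (hw : IsOGrEvenWeight n β) (h0 : β ≠ 0)
    (h1 : β ≠ lw [1]) (hr : slDim n β < (n : ℚ) * (n - 1) / 2) :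
    ∃ k : ℕ, 0 < k ∧ (β = lineWt n (k / 2) ∨ β = stdWt n (k / 2) ∨ β = dualWt n (k / 2)) := by
  have anti := hw.antitone
  obtain ⟨k, hk⟩ := hw.exists_half (i := 1) (by omega)
  have mid : ∀ i, 1 ≤ i → i + 1 < n → β i = k / 2 := by
    intro i hi
    induction i, hi using Nat.le_induction with
    | base => exact fun _ => hk
    | succ i hi ih =>
      intro hin
      obtain ⟨g, hg⟩ := hw.exists_nat_sub (i := i) (j := i + 1) (by omega) (by omega)
      rcases Nat.eq_zero_or_pos g with rfl | hpos
      · rw [← ih (by omega)]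
        push_cast at hg
        linarith
      · exfalso
        have hg1 : (1 : ℚ) ≤ g := by exact_mod_cast hpos
        have := choose_le_slDim anti (k := i + 1) (by omega) (by omega)
          (by rw [Nat.add_sub_cancel, hg]; exact hg1)
        have h2 : (n.choose 2 : ℚ) ≤ n.choose (i + 1) := by
          exact_mod_cast choose_two_le_choose (by omega) (by omega)
        rw [Nat.cast_choose_two] at h2
        linarith
  obtain ⟨a, ha⟩ := hw.exists_nat_sub (i := 0) (j := 1) (by omega) (by omega)
  obtain ⟨b, hb⟩ := hw.exists_nat_sub (i := n - 2) (j := n - 1) (by omega) (by omega)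
  have hn' : (4 : ℚ) ≤ n := by exact_mod_cast hn
  have ha2 : a < 2 := by
    by_contra! h
    have h : (2 : ℚ) ≤ a := by exact_mod_cast h
    obtain ⟨m, rfl⟩ : ∃ m, n = m + 1 := ⟨n - 1, by omega⟩
    have := symm_sq_le_slDim anti (ha ▸ h)
    push_cast at hr hn'
    nlinarith
  have hb2 : b < 2 := by
    by_contra! h
    have h : (2 : ℚ) ≤ b := by exact_mod_cast h
    obtain ⟨m, rfl⟩ : ∃ m, n = m + 1 := ⟨n - 1, by omega⟩
    have := symm_sq_le_slDim (m := m) (β := fun i => -β (m + 1 - 1 - i))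
      (fun i j hij hj => neg_le_neg (anti _ _ (by omega) (by omega))) (by
        have e : m + 1 - 2 = m - 1 := by omega
        rw [e] at hb
        simp only [Nat.add_sub_cancel, Nat.sub_zero] at hb ⊢
        linarith)
    rw [slDim_dual] at this
    push_cast at hr hn'
    nlinarith
  have hab : ¬ (a = 1 ∧ b = 1) := by
    rintro ⟨rfl, rfl⟩
    obtain ⟨m, rfl⟩ : ∃ m, n = m + 2 := ⟨n - 2, by omega⟩
    have := adjoint_le_slDim anti (by rw [ha]; norm_num)
      (by simpa using hb.symm.le)
    push_cast at hr hn'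
    nlinarith
  have hbot := mid (n - 2) (by omega) (by omega)
  have hlast := hw.2.2.1 (n - 2) (by omega)
  have hz := hw.2.2.2
  have cases_idx : ∀ i, i = 0 ∨ (1 ≤ i ∧ i + 1 < n) ∨ i = n - 1 ∨ n ≤ i := by omega
  have hshape : (β = lineWt n (k / 2) ∨ β = stdWt n (k / 2) ∨ β = dualWt n (k / 2)) := by
    rcases (show (a = 0 ∧ b = 0) ∨ (a = 1 ∧ b = 0) ∨ (a = 0 ∧ b = 1) by omega) with
      ⟨rfl, rfl⟩ | ⟨rfl, rfl⟩ | ⟨rfl, rfl⟩ <;> push_cast at ha hb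
    · left
      funext i
      unfold lineWt
      rcases cases_idx i with rfl | ⟨h, h'⟩ | rfl | h
      · rw [if_pos (by omega)]; linarith
      · rw [if_pos (by omega)]; exact mid i h h'
      · rw [if_pos (by omega)]; linarith
      · rw [if_neg (by omega)]; exact hz i h
    · right; left
      funext i
      unfold stdWt
      rcases cases_idx i with rfl | ⟨h, h'⟩ | rfl | h
      · rw [if_pos (by omega)]; linarith
      · rw [if_neg (by omega), if_pos (by omega)]; exact mid i h h'
      · rw [if_neg (by omega), if_pos (by omega)]; linarith
      · rw [if_neg (by omega), if_neg (by omega)]; exact hz i h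
    · right; right
      funext i
      unfold dualWt
      rcases cases_idx i with rfl | ⟨h, h'⟩ | rfl | h
      · rw [if_pos (by omega)]; linarith
      · rw [if_pos (by omega)]; exact mid i h h'
      · rw [if_neg (by omega), if_pos (by omega)]; linarith
      · rw [if_neg (by omega), if_neg (by omega)]; exact hz i h
  refine ⟨k, Nat.pos_of_ne_zero ?_, hshape⟩
  rintro rfl
  rcases hshape with rfl | rfl | rfl
  · refine h0 (funext fun i => ?_)
    simp [lineWt]
  · refine h1 (funext fun i => ?_)
    cases i <;> simp [stdWt, lw]
  · rw [hbot] at hlast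
    have hl : dualWt n ((0 : ℕ) / 2) (n - 1) = -1 := by
      unfold dualWt
      rw [if_neg (by omega), if_pos (by omega)]
      norm_num
    rw [hl] at hlast
    norm_num at hlast

lemma headSum_lineWt (n : ℕ) (t : ℚ) : headSum n (lineWt n t) = n * t := by
  refine (sum_congr rfl (g := fun _ => t) fun i hi => if_pos (mem_range.1 hi)).trans ?_
  simp

lemma headSum_stdWt {n : ℕ} (hn : 1 ≤ n) (t : ℚ) : headSum n (stdWt n t) = n * t + 1 := by
  obtain ⟨m, rfl⟩ := Nat.exists_eq_add_of_le' hn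
  unfold headSum
  rw [sum_range_succ', sum_congr rfl (g := fun _ => t)]
  · simp [stdWt]; ring
  · intro i hi
    have := mem_range.1 hi
    simp [stdWt, this]

lemma headSum_dualWt {n : ℕ} (hn : 1 ≤ n) (t : ℚ) : headSum n (dualWt n t) = n * t - 1 := by
  obtain ⟨m, rfl⟩ := Nat.exists_eq_add_of_le' hn
  unfold headSum
  rw [sum_range_succ, sum_congr rfl (g := fun _ => t)]
  · simp [dualWt]; ring
  · intro i hi
    have := mem_range.1 hi
    simp [dualWt, this]

lemma slDim_lineWt (n : ℕ) (t : ℚ) : slDim n (lineWt n t) = 1 := by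
  refine prod_eq_one fun i hi => prod_eq_one fun j hj => ?_
  have hi := mem_range.1 hi
  have hj := mem_range.1 hj
  split_ifs with h
  · have : ((j : ℚ) - i) ≠ 0 := sub_ne_zero.2 (by exact_mod_cast h.ne')
    simp [lineWt, hi, hj, this]
  · rfl

lemma slDim_stdWt {n : ℕ} (hn : 1 ≤ n) (t : ℚ) : slDim n (stdWt n t) = n := by
  obtain ⟨m, rfl⟩ := Nat.exists_eq_add_of_le' hn
  unfold slDim
  rw [prod_range_succ', prod_eq_one, one_mul, prod_range_succ']
  · have := prod_range_telescope 1 one_pos m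
    simp only [Nat.zero_lt_succ, if_true, lt_irrefl, if_false, mul_one]
    push_cast
    rw [show (m : ℚ) + 1 = (1 + m) / 1 by ring, ← this]
    refine prod_congr rfl fun x hx => ?_
    have := mem_range.1 hx
    simp only [stdWt, if_true, Nat.add_lt_add_iff_right, this, Nat.succ_ne_zero, if_false]
    congr 1 <;> ring
  · intro i hi
    refine prod_eq_one fun j hj => ?_
    have hi := mem_range.1 hi
    have hj := mem_range.1 hj
    split_ifs with h
    · have : ((j : ℚ) - (i + 1 : ℕ)) ≠ 0 := sub_ne_zero.2 (by exact_mod_cast h.ne')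
      have hj0 : j ≠ 0 := by omega
      simp only [stdWt, hj0, hj, Nat.succ_ne_zero, if_false, Nat.add_lt_add_iff_right, hi, if_true]
      rw [add_sub_cancel_right, div_self this]
    · rfl

lemma slDim_congr {n : ℕ} {β γ : ℕ → ℚ} (h : ∀ i < n, β i = γ i) : slDim n β = slDim n γ := by
  refine prod_congr rfl fun i hi => prod_congr rfl fun j hj => ?_
  rw [h i (mem_range.1 hi), h j (mem_range.1 hj)]

lemma slDim_dualWt {n : ℕ} (hn : 1 ≤ n) (t : ℚ) : slDim n (dualWt n t) = n := by
  rw [← slDim_dual, ← slDim_stdWt hn (-t)]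
  refine slDim_congr fun i hi => ?_
  unfold dualWt stdWt
  rcases Nat.eq_zero_or_pos i with rfl | h
  · rw [if_neg (by omega), if_pos (by omega), if_pos rfl]
    ring
  · rw [if_pos (by omega), if_neg (by omega), if_pos hi]

lemma card_le_sum_of_pos {M : Multiset ℕ} (h : ∀ k ∈ M, 0 < k) : M.card ≤ M.sum := by
  simpa using Multiset.card_nsmul_le_sum h

lemma eq_replicate_of_sum_eq_card {M : Multiset ℕ} (h : ∀ k ∈ M, 0 < k) (hs : M.sum = M.card) :
    M = Multiset.replicate M.card 1 := by
  refine Multiset.eq_replicate.2 ⟨rfl, fun k hk => ?_⟩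
  obtain ⟨T, rfl⟩ := Multiset.exists_cons_of_mem hk
  have h1 := card_le_sum_of_pos fun x hx => h x (Multiset.mem_cons_of_mem hx)
  have h2 := h k hk
  rw [Multiset.sum_cons, Multiset.card_cons] at hs
  omega

lemma exists_cons_of_card_lt_sum {M : Multiset ℕ} (h : ∀ k ∈ M, 0 < k) (hs : M.card < M.sum) :
    ∃ x T, 2 ≤ x ∧ M = x ::ₘ T ∧ (∀ k ∈ T, 0 < k) ∧ T.card ≤ T.sum := by
  by_contra! hcon
  have : M = Multiset.replicate M.card 1 := by
    refine Multiset.eq_replicate.2 ⟨rfl, fun k hk => ?_⟩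
    by_contra hne
    obtain ⟨T, rfl⟩ := Multiset.exists_cons_of_mem hk
    have hT : ∀ x ∈ T, 0 < x := fun x hx => h x (Multiset.mem_cons_of_mem hx)
    have := hcon k T (by have := h k hk; omega) rfl hT
    exact absurd (card_le_sum_of_pos hT) this.not_ge
  rw [this] at hs
  simp at hs

lemma eq_of_sum_eq_card_add_one {M : Multiset ℕ} (h : ∀ k ∈ M, 0 < k)
    (hs : M.sum = M.card + 1) : M = 2 ::ₘ Multiset.replicate (M.card - 1) 1 := by
  obtain ⟨x, T, hx, rfl, hT, hle⟩ := exists_cons_of_card_lt_sum h (by omega)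
  rw [Multiset.sum_cons, Multiset.card_cons] at hs
  obtain rfl : x = 2 := by omega
  rw [Multiset.card_cons, Nat.add_sub_cancel,
    ← eq_replicate_of_sum_eq_card hT (by omega)]

lemma eq_of_sum_eq_card_add_two {M : Multiset ℕ} (h : ∀ k ∈ M, 0 < k)
    (hs : M.sum = M.card + 2) : M = 3 ::ₘ Multiset.replicate (M.card - 1) 1 ∨
      M = 2 ::ₘ 2 ::ₘ Multiset.replicate (M.card - 2) 1 := by
  obtain ⟨x, T, hx, rfl, hT, hle⟩ := exists_cons_of_card_lt_sum h (by omega)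
  rw [Multiset.sum_cons, Multiset.card_cons] at hs
  rw [Multiset.card_cons, Nat.add_sub_cancel]
  rcases (show x = 2 ∨ x = 3 by omega) with rfl | rfl
  · right
    rw [show T.card + 1 - 2 = T.card - 1 by omega,
      ← eq_of_sum_eq_card_add_one hT (by omega)]
  · left
    rw [← eq_replicate_of_sum_eq_card hT (by omega)]

/-- The sum of line bundles and twists of the standard bundle and its dual, with twists by
`O(k/2)` for `k` in the given multisets. -/
def bundleSum (n : ℕ) (M A B : Multiset ℕ) : Multiset (ℕ → ℚ) :=
  M.map (fun k : ℕ => lineWt n (k / 2)) + A.map (fun k : ℕ => stdWt n (k / 2)) +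
    B.map (fun k : ℕ => dualWt n (k / 2))

lemma exists_eq_bundleSum {n : ℕ} {S : Multiset (ℕ → ℚ)}
    (h : ∀ β ∈ S, ∃ k : ℕ, 0 < k ∧
      (β = lineWt n (k / 2) ∨ β = stdWt n (k / 2) ∨ β = dualWt n (k / 2))) :
    ∃ M A B : Multiset ℕ, (∀ k ∈ M, 0 < k) ∧ (∀ k ∈ A, 0 < k) ∧ (∀ k ∈ B, 0 < k) ∧
      S = bundleSum n M A B := by
  induction S using Multiset.induction with
  | empty => exact ⟨0, 0, 0, by simp, by simp, by simp, by simp [bundleSum]⟩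
  | cons β S ih =>
    obtain ⟨M, A, B, hM, hA, hB, rfl⟩ := ih fun β hβ => h β (Multiset.mem_cons_of_mem hβ)
    obtain ⟨k, hk, rfl | rfl | rfl⟩ := h β (Multiset.mem_cons_self _ _)
    · exact ⟨k ::ₘ M, A, B, by simpa [hk] using hM, hA, hB, by simp [bundleSum]⟩
    · exact ⟨M, k ::ₘ A, B, hM, by simpa [hk] using hA, hB, by simp [bundleSum]⟩
    · exact ⟨M, A, k ::ₘ B, hM, hA, by simpa [hk] using hB, by simp [bundleSum]⟩

lemma sum_slDim_bundleSum {n : ℕ} (hn : 1 ≤ n) (M A B : Multiset ℕ) :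
    ((bundleSum n M A B).map (slDim n)).sum = M.card + n * (A.card + B.card) := by
  simp only [bundleSum, Multiset.map_add, Multiset.map_map, Function.comp_def, slDim_lineWt,
    slDim_stdWt hn, slDim_dualWt hn, Multiset.sum_add, Multiset.map_const', Multiset.sum_replicate]
  simp only [nsmul_eq_mul]
  ring

lemma sum_dex_bundleSum {n : ℕ} (hn : 1 ≤ n) (M A B : Multiset ℕ) :
    ((bundleSum n M A B).map (fun β => headSum n β / (n : ℚ) * slDim n β)).sum =
      (M.sum + n * A.sum + n * B.sum) / 2 + A.card - B.card := by
  have hn0 : (n : ℚ) ≠ 0 := by exact_mod_cast (by omega : n ≠ 0)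
  simp only [bundleSum, Multiset.map_add, Multiset.map_map, Function.comp_def, slDim_lineWt,
    slDim_stdWt hn, slDim_dualWt hn, Multiset.sum_add, headSum_lineWt, headSum_stdWt hn,
    headSum_dualWt hn]
  have e1 : (M.map fun k : ℕ => (n : ℚ) * ((k : ℚ) / 2) / n * 1).sum = M.sum / 2 := by
    induction M using Multiset.induction with
    | empty => simp
    | cons k M ih => simp only [Multiset.map_cons, Multiset.sum_cons, ih]; push_cast; field_simp
  have e2 : (A.map fun k : ℕ => ((n : ℚ) * ((k : ℚ) / 2) + 1) / n * n).sum =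
      n * A.sum / 2 + A.card := by
    induction A using Multiset.induction with
    | empty => simp
    | cons k M ih =>
      simp only [Multiset.map_cons, Multiset.sum_cons, Multiset.card_cons, ih]
      push_cast; field_simp; ring
  have e3 : (B.map fun k : ℕ => ((n : ℚ) * ((k : ℚ) / 2) - 1) / n * n).sum =
      n * B.sum / 2 - B.card := by
    induction B using Multiset.induction with
    | empty => simp
    | cons k M ih =>
      simp only [Multiset.map_cons, Multiset.sum_cons, Multiset.card_cons, ih]
      push_cast; field_simp; ring
  rw [e1, e2, e3]
  ring

lemma lineWt_eq_lw (n : ℕ) (t : ℚ) : lineWt n t = lw (List.replicate n t) := by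
  funext i
  by_cases h : i < n <;> simp [lineWt, lw, List.getD_eq_getElem?_getD, h]

lemma stdWt_eq_lw (n : ℕ) (t : ℚ) :
    stdWt (n + 1) t = lw ((t + 1) :: List.replicate n t) := by
  funext i
  cases i with
  | zero => simp [stdWt, lw]
  | succ i =>
    by_cases h : i < n <;> simp [stdWt, lw, List.getD_eq_getElem?_getD, h]

lemma dualWt_eq_lw (n : ℕ) (t : ℚ) :
    dualWt (n + 1) t = lw (List.replicate n t ++ [t - 1]) := by
  funext i
  rcases lt_trichotomy i n with h | rfl | h
  · simp [dualWt, lw, List.getD_eq_getElem?_getD, List.getElem?_append, h]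
  · simp [dualWt, lw, List.getD_eq_getElem?_getD]
  · have h1 : ¬ i + 1 < n + 1 := by omega
    have h2 : ¬ i + 1 = n + 1 := by omega
    have h3 : n + 1 ≤ i := h
    unfold dualWt lw
    rw [if_neg h1, if_neg h2, List.getD_eq_default _ _ (by simpa using h3)]

/-- Classification of fourfolds with trivial canonical bundle in the maximal even
orthogonal Grassmannians `OGr(n,2n)`, where `rank(β) = D_n(β)`. -/
theorem stmt18 (n : ℕ) (hn : 2 ≤ n)
    (S : Multiset (ℕ → ℚ))
    (hw : ∀ β ∈ S, IsOGrEvenWeight n β ∧ β ≠ 0 ∧ β ≠ lw [1])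
    (hnew : ∃ β ∈ S, (∃ i, i < n ∧ ∀ z : ℤ, β i ≠ (z : ℚ)) ∨ β (n - 1) < 0)
    (hr : (S.map (slDim n)).sum = (n : ℚ) * ((n : ℚ) - 1) / 2 - 4)
    (hd : (S.map (fun β => headSum n β / (n : ℚ) * slDim n β)).sum = (n : ℚ) - 1) :
    ∃ S', (S' = S ∨ S' = S.map (negLast n)) ∧
      ((n = 4 ∧ S' = {lw [1/2, 1/2, 1/2, 1/2], lw [5/2, 5/2, 5/2, 5/2]}) ∨
       (n = 4 ∧ S' = {lw [3/2, 3/2, 3/2, 3/2], lw [3/2, 3/2, 3/2, 3/2]}) ∨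
       (n = 5 ∧ S' = {lw [1/2, 1/2, 1/2, 1/2, -(1/2)], lw [5/2, 5/2, 5/2, 5/2, 5/2]}) ∨
       (n = 5 ∧ S' = Multiset.replicate 4 (lw [1/2, 1/2, 1/2, 1/2, 1/2]) +
          {lw [1, 1, 1, 1, 1], lw [1, 1, 1, 1, 1]}) ∨
       (n = 5 ∧ S' = Multiset.replicate 5 (lw [1/2, 1/2, 1/2, 1/2, 1/2]) +
          {lw [3/2, 3/2, 3/2, 3/2, 3/2]}) ∨
       (n = 5 ∧ S' = {lw [1/2, 1/2, 1/2, 1/2, 1/2], lw [3/2, 1/2, 1/2, 1/2, 1/2]}) ∨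
       (n = 6 ∧ S' = {lw [1/2, 1/2, 1/2, 1/2, 1/2, -(1/2)]} +
          Multiset.replicate 4 (lw [1/2, 1/2, 1/2, 1/2, 1/2, 1/2]) +
          {lw [1, 1, 1, 1, 1, 1]})) := by
  have hone : ∀ β ∈ S, 1 ≤ slDim n β := fun β hβ => one_le_slDim_s18 (hw β hβ).1.antitone
  have hpos : ∀ x ∈ S.map (slDim n), 0 ≤ x := by
    intro x hx
    obtain ⟨β, hβ, rfl⟩ := Multiset.mem_map.1 hx
    exact zero_le_one.trans (hone β hβ)
  have hn4 : 4 ≤ n := by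
    by_contra! h
    have := Multiset.sum_nonneg hpos
    rw [hr] at this
    interval_cases n <;> norm_num at this
  have hshape := fun β (hβ : β ∈ S) => eq_of_slDim_lt hn4 (hw β hβ).1 (hw β hβ).2.1 (hw β hβ).2.2
    (lt_of_le_of_lt (Multiset.single_le_sum hpos _ (Multiset.mem_map_of_mem _ hβ))
      (by rw [hr]; linarith))
  obtain ⟨M, A, B, hM, hA, hB, rfl⟩ := exists_eq_bundleSum hshape
  rw [sum_slDim_bundleSum (by omega)] at hr
  rw [sum_dex_bundleSum (by omega)] at hd
  have cM := card_le_sum_of_pos hM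
  have cA := card_le_sum_of_pos hA
  have cB := card_le_sum_of_pos hB
  have hn7 : n < 7 := by
    by_contra! h
    obtain ⟨x, rfl⟩ := Nat.exists_eq_add_of_le h
    have cM' : (M.card : ℚ) ≤ M.sum := by exact_mod_cast cM
    have cA' : (A.card : ℚ) ≤ A.sum := by exact_mod_cast cA
    have cB' : (B.card : ℚ) ≤ B.sum := by exact_mod_cast cB
    simp only [Nat.cast_add, Nat.cast_ofNat] at hr hd
    have hx : (0 : ℚ) ≤ x := x.cast_nonneg
    have hlow : (M.card : ℚ) + (7 + x) * (A.card + B.card) - 2 * B.card ≤ 2 * (7 + x - 1) := by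
      nlinarith [mul_nonneg hx (sub_nonneg.2 cA'), mul_nonneg hx (sub_nonneg.2 cB'),
        (A.card.cast_nonneg : (0 : ℚ) ≤ _)]
    have hB7 : (7 + x : ℚ) * B.card ≤ (7 + x) * (7 + x - 1) / 2 - 4 := by
      nlinarith [mul_nonneg hx (A.card.cast_nonneg : (0 : ℚ) ≤ _),
        (A.card.cast_nonneg : (0 : ℚ) ≤ _), (M.card.cast_nonneg : (0 : ℚ) ≤ _)]
    rw [hr] at hlow
    have := mul_le_mul_of_nonneg_left hlow (by positivity : (0 : ℚ) ≤ 7 + x)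
    nlinarith [pow_nonneg hx 3, pow_nonneg hx 2]
  refine ⟨_, Or.inl rfl, ?_⟩
  rcases (show n = 4 ∨ n = 5 ∨ n = 6 by omega) with rfl | rfl | rfl
  · have hr' : M.card + 4 * (A.card + B.card) = 2 := by
      have : (M.card + 4 * (A.card + B.card) : ℚ) = 2 := by push_cast at hr; linarith
      exact_mod_cast this
    obtain rfl : A = 0 := Multiset.card_eq_zero.1 (by omega)
    obtain rfl : B = 0 := Multiset.card_eq_zero.1 (by omega)
    have hd' : M.sum = 6 := by
      have : (M.sum : ℚ) = 6 := by
        simp only [Nat.cast_ofNat, Multiset.sum_zero, Multiset.card_zero, Nat.cast_zero] at hd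
        linarith
      exact_mod_cast this
    obtain ⟨x, y, rfl⟩ := Multiset.card_eq_two.1 (show M.card = 2 by simpa using hr')
    have hx : 0 < x := hM x (by simp)
    have hy : 0 < y := hM y (by simp)
    have hxy : x + y = 6 := by simpa using hd'
    rcases (show (x = 1 ∧ y = 5) ∨ (x = 5 ∧ y = 1) ∨ (x = 3 ∧ y = 3) ∨
        (x = 2 ∧ y = 4) ∨ (x = 4 ∧ y = 2) by omega) with
      ⟨rfl, rfl⟩ | ⟨rfl, rfl⟩ | ⟨rfl, rfl⟩ | ⟨rfl, rfl⟩ | ⟨rfl, rfl⟩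
    · left
      simp [bundleSum, lineWt_eq_lw, List.replicate]
    · left
      rw [Multiset.pair_comm 5 1]
      simp [bundleSum, lineWt_eq_lw, List.replicate]
    · right; left
      simp [bundleSum, lineWt_eq_lw, List.replicate]
    all_goals
      exfalso
      obtain ⟨β, hβ, hβ'⟩ := hnew
      simp only [bundleSum, Multiset.map_zero, add_zero, Multiset.insert_eq_cons,
        Multiset.map_cons, Multiset.map_singleton, Multiset.mem_cons,
        Multiset.mem_singleton] at hβ
      have : β = lineWt 4 (1 : ℤ) ∨ β = lineWt 4 (2 : ℤ) := by
        norm_num at hβ ⊢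
        tauto
      rcases this with rfl | rfl <;> rcases hβ' with ⟨i, hi, h⟩ | h
      all_goals first
        | exact h _ (if_pos hi)
        | norm_num [lineWt] at h
  · have hr' : M.card + 5 * (A.card + B.card) = 6 := by
      have : (M.card + 5 * (A.card + B.card) : ℚ) = 6 := by push_cast at hr; linarith
      exact_mod_cast this
    have hd' : M.sum + 5 * A.sum + 5 * B.sum + 2 * A.card = 8 + 2 * B.card := by
      have : (M.sum + 5 * A.sum + 5 * B.sum + 2 * A.card : ℚ) = 8 + 2 * B.card := by
        simp only [Nat.cast_ofNat] at hd
        linarith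
      exact_mod_cast this
    rcases (show (A.card = 0 ∧ B.card = 0) ∨ (A.card = 1 ∧ B.card = 0) ∨
        (A.card = 0 ∧ B.card = 1) by omega) with ⟨hA', hB'⟩ | ⟨hA', hB'⟩ | ⟨hA', hB'⟩
    · obtain rfl := Multiset.card_eq_zero.1 hA'
      obtain rfl := Multiset.card_eq_zero.1 hB'
      have hc : M.card = 6 := by simpa using hr'
      have hs : M.sum = 8 := by simpa using hd'
      rcases eq_of_sum_eq_card_add_two hM (by omega) with h | h <;> rw [hc] at h <;> subst h
      · right; right; right; right; left
        refine ⟨rfl, ?_⟩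
        simp only [bundleSum, lineWt_eq_lw, Multiset.map_cons, Multiset.map_replicate,
          Multiset.map_zero, add_zero, List.replicate]
        rw [← Multiset.singleton_add, add_comm]
        norm_num
      · right; right; right; left
        refine ⟨rfl, ?_⟩
        simp only [bundleSum, lineWt_eq_lw, Multiset.map_add, Multiset.map_singleton,
          Multiset.map_replicate, Multiset.map_zero, add_zero, List.replicate,
          Multiset.insert_eq_cons, ← Multiset.singleton_add]
        norm_num1
        abel
    · obtain ⟨a, rfl⟩ := Multiset.card_eq_one.1 hA'
      obtain rfl := Multiset.card_eq_zero.1 hB'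
      obtain ⟨x, rfl⟩ := Multiset.card_eq_one.1 (show M.card = 1 by omega)
      simp only [Multiset.sum_singleton, Multiset.card_singleton, Multiset.sum_zero,
        Multiset.card_zero] at hd' cM cA
      obtain rfl : a = 1 := by omega
      obtain rfl : x = 1 := by omega
      right; right; right; right; right; left
      refine ⟨rfl, ?_⟩
      simp only [bundleSum, lineWt_eq_lw, stdWt_eq_lw, Multiset.map_singleton, Multiset.map_zero,
        add_zero, List.replicate, Multiset.insert_eq_cons, ← Multiset.singleton_add]
      norm_num
    · obtain rfl := Multiset.card_eq_zero.1 hA'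
      obtain ⟨b, rfl⟩ := Multiset.card_eq_one.1 hB'
      obtain ⟨x, rfl⟩ := Multiset.card_eq_one.1 (show M.card = 1 by omega)
      simp only [Multiset.sum_singleton, Multiset.card_singleton, Multiset.sum_zero,
        Multiset.card_zero] at hd' cM cB
      obtain rfl : b = 1 := by omega
      obtain rfl : x = 5 := by omega
      right; right; left
      refine ⟨rfl, ?_⟩
      simp only [bundleSum, lineWt_eq_lw, dualWt_eq_lw, Multiset.map_singleton, Multiset.map_zero,
        add_zero, List.replicate, Multiset.insert_eq_cons, ← Multiset.singleton_add]
      rw [add_comm]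
      norm_num
  · have hr' : M.card + 6 * (A.card + B.card) = 11 := by
      have : (M.card + 6 * (A.card + B.card) : ℚ) = 11 := by push_cast at hr; linarith
      exact_mod_cast this
    have hd' : M.sum + 6 * A.sum + 6 * B.sum + 2 * A.card = 10 + 2 * B.card := by
      have : (M.sum + 6 * A.sum + 6 * B.sum + 2 * A.card : ℚ) = 10 + 2 * B.card := by
        simp only [Nat.cast_ofNat] at hd
        linarith
      exact_mod_cast this
    obtain rfl : A = 0 := Multiset.card_eq_zero.1 (by omega)
    obtain ⟨b, rfl⟩ := Multiset.card_eq_one.1 (show B.card = 1 by simp at hr' hd' ⊢; omega)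
    simp only [Multiset.sum_singleton, Multiset.card_singleton, Multiset.sum_zero,
      Multiset.card_zero] at hd' hr' cB
    have hc : M.card = 5 := by omega
    obtain rfl : b = 1 := by omega
    have h := eq_of_sum_eq_card_add_one hM (by omega)
    rw [hc] at h
    subst h
    right; right; right; right; right; right
    refine ⟨rfl, ?_⟩
    simp only [bundleSum, lineWt_eq_lw, dualWt_eq_lw, Multiset.map_add, Multiset.map_replicate,
      Multiset.map_singleton, Multiset.map_zero, add_zero, List.replicate, List.cons_append,
      List.nil_append,
      ← Multiset.singleton_add]
    norm_num1
    abel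
end
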